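/- Let {X_n} be a stationary and ergodic time series with values in a finite or countably infinite set 𝒳, and suppose the conditional expectation F(X⁰_{−∞}) = E(f(X_1)|X⁰_{−∞}) is almost surely continuous. Then almost surely lim_{n→∞} f_n = F(X̃⁰_{−∞}) and lim_{n→∞} |f_n − E(f(X_{λ_n+1}) | X_0^{λ_n})| = 0. -/

import Mathlib

open MeasureTheory Filter Set
open scoped ENNReal Topology

noncomputable section

namespace MWPrediction

/-- The canonical two-sided path space for a process with values in `𝒳`. -/
abbrev Path (𝒳 : Type*) := ℤ → 𝒳

variable {𝒳 : Type*}

/-- The left shift `(T ω) i = ω (i+1)` on two-sided sequences. -/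
def shift (ω : Path 𝒳) : Path 𝒳 := fun i => ω (i + 1)

/-- The one-sided past `X⁰_{-∞}`, recorded as `past ω i = X_{-i}`. -/
def past (ω : Path 𝒳) : ℕ → 𝒳 := fun i => ω (-(i : ℤ))

/-- The string `s` of length `m` (read right-to-left: `s j` is the symbol at
position `t - j`) occurs in `ω` ending at time `t`. -/
def OccursAt (ω : Path 𝒳) (m : ℕ) (s : ℕ → 𝒳) (t : ℤ) : Prop :=
  ∀ j < m, ω (t - (j : ℤ)) = s j

/-- The auxiliary stopping times `ζ_n`:  `ζ_0 = 0` and `ζ_n` is obtained from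
`ζ_{n-1}` by waiting for the recurrence of the block of length `l n` ending
at `ζ_{n-1}`. -/
def zeta (l : ℕ → ℕ) (ω : Path 𝒳) : ℕ → ℤ
  | 0 => 0
  | n + 1 =>
    zeta l ω n +
      ((sInf {t : ℕ | 0 < t ∧ ∀ s < l (n + 1),
          ω (zeta l ω n - (s : ℤ) + (t : ℤ)) = ω (zeta l ω n - (s : ℤ))} : ℕ) : ℤ)

/-- `J n = min { j ≥ 1 : l (j+1) > n }`. -/
def Jfun (l : ℕ → ℕ) (n : ℕ) : ℕ := sInf {j : ℕ | 1 ≤ j ∧ n < l (j + 1)}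

/-- The auxiliary process `X̃`: `tildePast l ω i = X̃_{-i} = X_{ζ_{J(i)} - i}`. -/
def tildePast (l : ℕ → ℕ) (ω : Path 𝒳) : ℕ → 𝒳 :=
  fun i => ω (zeta l ω (Jfun l i) - (i : ℤ))

variable [MeasurableSpace 𝒳]

/-- `pstr μ m s = P(X_{-m+1}^0 = s)`, the probability that the string `s` of
length `m` (read right-to-left) occupies positions `-m+1, …, 0`.
(So `pstr μ (k+1)` is `p_k` of the paper.) -/
def pstr (μ : Measure (Path 𝒳)) (m : ℕ) (s : ℕ → 𝒳) : ℝ :=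
  (μ {ω | ∀ j < m, ω (-(j : ℤ)) = s j}).toReal

/-- `pcond μ m y s = P(X_1 = y | X_{-m+1}^0 = s)`, conditioning on `m` symbols.
(So `pcond μ m` is `p_{m-1}(·|·)` of the paper.) -/
def pcond (μ : Measure (Path 𝒳)) (m : ℕ) (y : 𝒳) (s : ℕ → 𝒳) : ℝ :=
  (μ {ω | ω 1 = y ∧ ∀ j < m, ω (-(j : ℤ)) = s j}).toReal / pstr μ m s

/-- Append `y` as the new rightmost symbol of the string `s`. -/
def withLast (y : 𝒳) (s : ℕ → 𝒳) : ℕ → 𝒳 := fun j => if j = 0 then y else s (j - 1)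

/-- The string which agrees with `b` on its rightmost `k` symbols and continues
to the left with `z`:  this is the string `(z, b_{-k+1}^0)` of the paper. -/
def prependOld (b : ℕ → 𝒳) (k : ℕ) (z : ℕ → 𝒳) : ℕ → 𝒳 :=
  fun j => if j < k then b j else z (j - k)

/-- `K` is a memory bound for the past `b`: for all `i ≥ 1`, `y` and `z ∈ 𝒳^i`,
if `p_{K+i}(z, b_{-K+1}^0, y) > 0` then
`p_{K-1}(y | b_{-K+1}^0) = p_{K+i-1}(y | z, b_{-K+1}^0)`. -/
def IsMemoryBound (μ : Measure (Path 𝒳)) (b : ℕ → 𝒳) (K : ℕ) : Prop :=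
  ∀ i : ℕ, 1 ≤ i → ∀ y : 𝒳, ∀ z : ℕ → 𝒳,
    0 < pstr μ (K + i + 1) (withLast y (prependOld b K z)) →
    pcond μ K y b = pcond μ (K + i) y (prependOld b K z)

/-- The (random) memory length `K(b)` of a one-sided path `b`: the smallest
memory bound, and `∞` if there is none. -/
def memLen (μ : Measure (Path 𝒳)) (b : ℕ → 𝒳) : ℕ∞ :=
  sInf {n : ℕ∞ | ∃ K : ℕ, n = (K : ℕ∞) ∧ IsMemoryBound μ b K}

/-- `Δ_k(b_{-k+1}^0)`. -/
def Delta (μ : Measure (Path 𝒳)) (k : ℕ) (b : ℕ → 𝒳) : ℝ :=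
  sSup {d : ℝ | ∃ i : ℕ, 1 ≤ i ∧ ∃ z : ℕ → 𝒳, ∃ x : 𝒳,
    0 < pstr μ (k + i + 1) (withLast x (prependOld b k z)) ∧
    d = |pcond μ k x b - pcond μ (k + i) x (prependOld b k z)|}

/-- `⌈n/2⌉`. -/
def half (n : ℕ) : ℕ := (n + 1) / 2

open Classical in
/-- The number of times `t ∈ [a, b]` at which the string `s` of length `m`
occurs in `ω` ending at `t`. -/
def cnt (ω : Path 𝒳) (m : ℕ) (s : ℕ → 𝒳) (a b : ℤ) : ℕ :=
  ((Finset.Icc a b).filter fun t => OccursAt ω m s t).card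

/-- Membership in `ℒ_{n,m}^{(1)}`: the string `s` of length `m+1` occurs in
`X_0^{⌈n/2⌉ - 1}`. -/
def inL1 (ω : Path 𝒳) (n m : ℕ) (s : ℕ → 𝒳) : Prop :=
  ∃ t : ℤ, (m : ℤ) ≤ t ∧ t ≤ (half n : ℤ) - 1 ∧ OccursAt ω (m + 1) s t

/-- Membership in `ℒ_{n,m}^{(2)}`: the string `s` of length `m+1` occurs more
than `n^{1-γ}` times in `X_{⌈n/2⌉}^n`. -/
def inL2 (γ : ℝ) (ω : Path 𝒳) (n m : ℕ) (s : ℕ → 𝒳) : Prop :=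
  (n : ℝ) ^ (1 - γ) < (cnt ω (m + 1) s ((half n : ℤ) + (m : ℤ)) (n : ℤ) : ℝ)

/-- Membership in `ℒ_m^n = ℒ_{n,m}^{(1)} ∩ ℒ_{n,m}^{(2)}`. -/
def inL (γ : ℝ) (ω : Path 𝒳) (n m : ℕ) (s : ℕ → 𝒳) : Prop :=
  inL1 ω n m s ∧ inL2 γ ω n m s

/-- The empirical conditional relative frequency of `x` following the string
`s` of length `m`, computed in the second half `X_{⌈n/2⌉}^n` of the data. -/
def empCond (ω : Path 𝒳) (n m : ℕ) (x : 𝒳) (s : ℕ → 𝒳) : ℝ :=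
  (cnt ω (m + 1) (withLast x s) ((half n : ℤ) + (m : ℤ)) (n : ℤ) : ℝ) /
    (cnt ω m s ((half n : ℤ) + (m : ℤ) - 1) ((n : ℤ) - 1) : ℝ)

/-- The empirical statistic `Δ̂_k^n(X̃_{-k+1}^0)`. -/
def hatDelta (γ : ℝ) (l : ℕ → ℕ) (ω : Path 𝒳) (n k : ℕ) : ℝ :=
  (if zeta l ω (Jfun l k) ≤ (half n : ℤ) - 1 then (1 : ℝ) else 0) *
    sSup {d : ℝ | ∃ i : ℕ, 1 ≤ i ∧ i ≤ n ∧ ∃ z : ℕ → 𝒳, ∃ x : 𝒳,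
      inL γ ω n (k + i) (withLast x (prependOld (tildePast l ω) k z)) ∧
      d = |empCond ω n k x (tildePast l ω) -
            empCond ω n (k + i) x (prependOld (tildePast l ω) k z)|}

/-- The order estimate `χ_n`: the smallest `0 ≤ k < n` with `Δ̂_k^n ≤ n^{-β}`
(and `χ_0 = 0`). -/
def chi (β γ : ℝ) (l : ℕ → ℕ) (ω : Path 𝒳) (n : ℕ) : ℕ :=
  sInf {k : ℕ | k < n ∧ hatDelta γ l ω n k ≤ (n : ℝ) ^ (-β)}

/-- The index `j` with `ζ_j ≤ v < ζ_{j+1}`. -/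
def jIndex (l : ℕ → ℕ) (ω : Path 𝒳) (v : ℤ) : ℕ := sInf {j : ℕ | v < zeta l ω (j + 1)}

/-- The stopping times `λ_n`:  `λ_0 = 0` and, if `ζ_j ≤ λ_{n-1} < ζ_{j+1}`,
`λ_n = min { t > λ_{n-1} : X_{t - χ_t + 1}^t = X_{ζ_j - χ_t + 1}^{ζ_j} }`. -/
def lambda (β γ : ℝ) (l : ℕ → ℕ) (ω : Path 𝒳) : ℕ → ℤ
  | 0 => 0
  | n + 1 =>
    lambda β γ l ω n + 1 +
      ((sInf {s : ℕ |
          ∀ r < chi β γ l ω (lambda β γ l ω n + 1 + (s : ℤ)).toNat,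
            ω (lambda β γ l ω n + 1 + (s : ℤ) - (r : ℤ)) =
              ω (zeta l ω (jIndex l ω (lambda β γ l ω n)) - (r : ℤ))} : ℕ) : ℤ)

/-- `κ_n = χ_{λ_n}`. -/
def kappa (β γ : ℝ) (l : ℕ → ℕ) (ω : Path 𝒳) (n : ℕ) : ℕ :=
  chi β γ l ω (lambda β γ l ω n).toNat

/-- The estimator `f_n = (1/n) ∑_{j=0}^{n-1} f(X_{λ_j + 1})`. -/
def fEst (β γ : ℝ) (l : ℕ → ℕ) (f : 𝒳 → ℝ) (ω : Path 𝒳) (n : ℕ) : ℝ :=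
  (1 / (n : ℝ)) * ∑ j ∈ Finset.range n, f (ω (lambda β γ l ω j + 1))

open Classical in
/-- The metric `d*` on one-sided sequences. -/
def dstar (x y : ℕ → 𝒳) : ℝ :=
  ∑' i : ℕ, (2 : ℝ)⁻¹ ^ (i + 1) * (if x i ≠ y i then 1 else 0)

/-- `F` restricted to `C` is continuous with respect to the metric `d*`. -/
def ContinuousOnDstar (F : (ℕ → 𝒳) → ℝ) (C : Set (ℕ → 𝒳)) : Prop :=
  ∀ x ∈ C, ∀ ε > 0, ∃ δ > 0, ∀ y ∈ C, dstar x y < δ → |F y - F x| < ε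

/-- The σ-algebra generated by the one-sided past `X^0_{-∞}`. -/
def pastSigma (𝒳 : Type*) [MeasurableSpace 𝒳] : MeasurableSpace (Path 𝒳) :=
  MeasurableSpace.comap past inferInstance

/-- `F` is a version of the conditional expectation `E(f(X_1) | X^0_{-∞})`. -/
def IsPredictor (μ : Measure (Path 𝒳)) (f : 𝒳 → ℝ) (F : (ℕ → 𝒳) → ℝ) : Prop :=
  (fun ω => F (past ω)) =ᵐ[μ] μ[fun ω => f (ω 1)|pastSigma 𝒳]

/-- `F` (a version of `E(f(X_1)|X^0_{-∞})`) is almost surely continuous: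
it is continuous w.r.t. `d*` on a set of paths of probability one. -/
def ASContinuousCondExp (μ : Measure (Path 𝒳)) (F : (ℕ → 𝒳) → ℝ) : Prop :=
  ∃ C : Set (ℕ → 𝒳), μ (past ⁻¹' C) = 1 ∧ ContinuousOnDstar F C

/-- The observation `(λ_j, X_0^{λ_j})`, encoding the data segment available at
time `λ_j` (values before time `0` are clamped to `X_0`). -/
def segObs (β γ : ℝ) (l : ℕ → ℕ) (j : ℕ) (ω : Path 𝒳) : ℤ × (ℕ → 𝒳) :=
  (lambda β γ l ω j, fun i => ω (max (lambda β γ l ω j - (i : ℤ)) 0))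

/-- The σ-algebra generated by `(λ_j, X_0^{λ_j})`. -/
def segSigma (β γ : ℝ) (l : ℕ → ℕ) (j : ℕ) : MeasurableSpace (Path 𝒳) :=
  MeasurableSpace.comap (segObs β γ l j) inferInstance

/-- The observation `(λ_j, X_{-∞}^{λ_j})`: the full past at time `λ_j`. -/
def fullPastObs (β γ : ℝ) (l : ℕ → ℕ) (j : ℕ) (ω : Path 𝒳) : ℤ × (ℕ → 𝒳) :=
  (lambda β γ l ω j, fun i => ω (lambda β γ l ω j - (i : ℤ)))

/-- The σ-algebra generated by `(λ_j, X_{-∞}^{λ_j})`. -/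
def fullPastSigma (β γ : ℝ) (l : ℕ → ℕ) (j : ℕ) : MeasurableSpace (Path 𝒳) :=
  MeasurableSpace.comap (fullPastObs β γ l j) inferInstance

/-- The `n`-th term `-(1/(n+1)) ∑ p log₂ p` of the entropy rate. -/
def entropyTerm (μ : Measure (Path 𝒳)) (n : ℕ) : ℝ :=
  -(1 / ((n : ℝ) + 1)) *
    ∑' s : Fin (n + 1) → 𝒳,
      pstr μ (n + 1) (fun j => if h : j < n + 1 then s ⟨j, h⟩ else s ⟨0, Nat.succ_pos n⟩) *
        Real.logb 2
          (pstr μ (n + 1) (fun j => if h : j < n + 1 then s ⟨j, h⟩ else s ⟨0, Nat.succ_pos n⟩))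

/-- The process has entropy rate `H`. -/
def HasEntropyRate (μ : Measure (Path 𝒳)) (H : ℝ) : Prop :=
  Tendsto (entropyTerm μ) atTop (nhds H)

/-- The backward stopping times `ζ̂_i^k`. -/
def hatZeta (l : ℕ → ℕ) (k : ℕ) (ω : Path 𝒳) : ℕ → ℤ
  | 0 => 0
  | i + 1 =>
    hatZeta l k ω i -
      ((sInf {t : ℕ | 0 < t ∧ ∀ s < l (k - i),
          ω (hatZeta l k ω i - (s : ℤ) - (t : ℤ)) = ω (hatZeta l k ω i - (s : ℤ))} : ℕ) : ℤ)


section Birkhoff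

variable {α : Type*}

/-- The running maximum `max (0, S_1 f, …, S_n f)` of Birkhoff sums, defined recursively. -/
def birkhoffMax (T : α → α) (f : α → ℝ) : ℕ → α → ℝ
  | 0 => fun _ => 0
  | n + 1 => fun x => max 0 (f x + birkhoffMax T f n (T x))

lemma birkhoffMax_nonneg (T : α → α) (f : α → ℝ) (n : ℕ) (x : α) : 0 ≤ birkhoffMax T f n x := by
  cases n with
  | zero => exact le_rfl
  | succ n => exact le_max_left _ _

lemma birkhoffMax_le_succ (T : α → α) (f : α → ℝ) (n : ℕ) (x : α) :
    birkhoffMax T f n x ≤ birkhoffMax T f (n + 1) x := by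
  induction n generalizing x with
  | zero => exact le_max_left _ _
  | succ n ih =>
    refine max_le_max le_rfl ?_
    linarith [ih (T x)]

lemma birkhoffMax_mono (T : α → α) (f : α → ℝ) (x : α) :
    Monotone fun n => birkhoffMax T f n x :=
  monotone_nat_of_le_succ fun n => birkhoffMax_le_succ T f n x

lemma birkhoffSum_le_birkhoffMax (T : α → α) (f : α → ℝ) (n : ℕ) (x : α) :
    birkhoffSum T f n x ≤ birkhoffMax T f n x := by
  induction n generalizing x with
  | zero => simp [birkhoffMax]
  | succ n ih =>
    rw [birkhoffSum_succ']
    exact le_trans (by linarith [ih (T x)]) (le_max_right _ _)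

variable [MeasurableSpace α]

lemma measurable_birkhoffMax {T : α → α} (hT : Measurable T) {f : α → ℝ} (hf : Measurable f)
    (n : ℕ) : Measurable (birkhoffMax T f n) := by
  induction n with
  | zero => exact measurable_const
  | succ n ih => exact measurable_const.max (hf.add (ih.comp hT))

variable {μ : Measure α}

lemma integrable_birkhoffMax {T : α → α} (hT : MeasurePreserving T μ μ) {f : α → ℝ}
    (hf : Integrable f μ) (n : ℕ) : Integrable (birkhoffMax T f n) μ := by
  induction n with
  | zero => exact integrable_zero _ _ _
  | succ n ih =>
    exact (integrable_zero _ _ _).sup (hf.add (hT.integrable_comp_of_integrable ih))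

/-- If the Birkhoff maxima are almost surely unbounded then the integral is nonnegative. -/
lemma integral_nonneg_of_birkhoffMax_tendsto {T : α → α} (hT : MeasurePreserving T μ μ)
    {f : α → ℝ} (hfm : Measurable f) (hf : Integrable f μ)
    (h : ∀ᵐ x ∂μ, Tendsto (fun n => birkhoffMax T f n x) atTop atTop) :
    0 ≤ ∫ x, f x ∂μ := by
  have hlim : Tendsto (fun n => ∫ x, max (f x) (-birkhoffMax T f n (T x)) ∂μ) atTop
      (𝓝 (∫ x, f x ∂μ)) := by
    refine tendsto_integral_of_dominated_convergence (fun x => |f x|) ?_ hf.abs ?_ ?_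
    · intro n
      exact (hfm.max ((measurable_birkhoffMax hT.measurable hfm n).comp
        hT.measurable).neg).aestronglyMeasurable
    · intro n
      refine ae_of_all _ fun x => ?_
      have := birkhoffMax_nonneg T f n (T x)
      rw [Real.norm_eq_abs, abs_le]
      refine ⟨le_trans (neg_abs_le (f x)) (le_max_left _ _), max_le (le_abs_self _) ?_⟩
      linarith [abs_nonneg (f x)]
    · filter_upwards [hT.quasiMeasurePreserving.ae h] with x hx
      refine tendsto_const_nhds.congr' ?_
      filter_upwards [hx.eventually_ge_atTop (-f x)] with n hn
      rw [max_eq_left]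
      linarith
  refine ge_of_tendsto' hlim fun n => ?_
  have hi := integrable_birkhoffMax hT hf n
  have hiT : Integrable (fun x => birkhoffMax T f n (T x)) μ := hT.integrable_comp_of_integrable hi
  have e1 : ∫ x, max (f x) (-birkhoffMax T f n (T x)) ∂μ =
      ∫ x, (birkhoffMax T f (n + 1) x - birkhoffMax T f n (T x)) ∂μ := by
    refine integral_congr_ae (ae_of_all _ fun x => ?_)
    simp only [birkhoffMax]
    rw [← max_sub_sub_right, max_comm]
    ring_nf
  have e2 : ∫ x, birkhoffMax T f n (T x) ∂μ = ∫ x, birkhoffMax T f n x ∂μ := by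
    have := integral_map (μ := μ) hT.measurable.aemeasurable
      (f := birkhoffMax T f n)
      (measurable_birkhoffMax hT.measurable hfm n).aestronglyMeasurable
    rw [hT.map_eq] at this
    exact this.symm
  rw [e1, integral_sub (integrable_birkhoffMax hT hf (n + 1)) hiT, e2, sub_nonneg]
  exact integral_mono hi (integrable_birkhoffMax hT hf (n + 1))
    fun x => birkhoffMax_le_succ T f n x

/-- For an ergodic map, Birkhoff sums of a function of negative mean are bounded above. -/
lemma birkhoffSum_bddAbove_of_integral_neg {T : α → α} (hT : Ergodic T μ)
    {f : α → ℝ} (hfm : Measurable f) (hf : Integrable f μ) (hneg : ∫ x, f x ∂μ < 0) :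
    ∀ᵐ x ∂μ, ∃ B, ∀ n, birkhoffSum T f n x ≤ B := by
  set s : Set α := {x | ∀ C : ℕ, ∃ n, (C : ℝ) < birkhoffMax T f n x} with hs
  have hsm : MeasurableSet s := by
    have : s = ⋂ C : ℕ, ⋃ n, {x | (C : ℝ) < birkhoffMax T f n x} := by
      ext x; simp [hs]
    rw [this]
    exact MeasurableSet.iInter fun C => MeasurableSet.iUnion fun n =>
      measurableSet_lt measurable_const (measurable_birkhoffMax hT.measurable hfm n)
  have hinv : T ⁻¹' s = s := by
    ext x
    simp only [hs, mem_preimage, mem_ofPred_eq]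
    constructor
    · intro h C
      obtain ⟨k, hk⟩ := exists_nat_gt ((C : ℝ) - f x)
      obtain ⟨n, hn⟩ := h k
      refine ⟨n + 1, lt_of_lt_of_le ?_ (le_max_right _ _)⟩
      linarith
    · intro h C
      obtain ⟨k, hk⟩ := exists_nat_gt ((C : ℝ) + |f x|)
      obtain ⟨n, hn⟩ := h k
      have h2 := hn.trans_le (birkhoffMax_le_succ T f n x)
      refine ⟨n, ?_⟩
      have h3 := abs_nonneg (f x)
      have h4 := le_abs_self (f x)
      have h5 : (0 : ℝ) ≤ C := Nat.cast_nonneg C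
      rcases lt_max_iff.1 h2 with h6 | h6 <;> linarith
  rcases hT.toPreErgodic.measure_self_or_compl_eq_zero hsm hinv with h0 | h0
  · filter_upwards [measure_eq_zero_iff_ae_notMem.1 h0] with x hx
    simp only [hs, mem_ofPred_eq, not_forall, not_exists, not_lt] at hx
    obtain ⟨C, hC⟩ := hx
    exact ⟨C, fun n => (birkhoffSum_le_birkhoffMax T f n x).trans (hC n)⟩
  · exfalso
    have : ∀ᵐ x ∂μ, Tendsto (fun n => birkhoffMax T f n x) atTop atTop := by
      filter_upwards [measure_eq_zero_iff_ae_notMem.1 h0] with x hx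
      simp only [mem_compl_iff, not_not] at hx
      refine tendsto_atTop_atTop_of_monotone (birkhoffMax_mono T f x) fun b => ?_
      obtain ⟨k, hk⟩ := exists_nat_gt b
      obtain ⟨n, hn⟩ := hx k
      exact ⟨n, by linarith⟩
    exact absurd (integral_nonneg_of_birkhoffMax_tendsto hT.toMeasurePreserving hfm hf this)
      (not_le.2 hneg)

variable [IsProbabilityMeasure μ]

lemma birkhoffSum_le_of_integral_lt {T : α → α} (hT : Ergodic T μ)
    {f : α → ℝ} (hfm : Measurable f) (hf : Integrable f μ) {c : ℝ} (hc : ∫ x, f x ∂μ < c) :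
    ∀ᵐ x ∂μ, ∃ B, ∀ n : ℕ, birkhoffSum T f n x ≤ B + n * c := by
  have h := birkhoffSum_bddAbove_of_integral_neg hT (f := fun x => f x - c)
    (hfm.sub measurable_const) (hf.sub (integrable_const c)) (by
      rw [integral_sub hf (integrable_const c)]; simpa using hc)
  filter_upwards [h] with x ⟨B, hB⟩
  refine ⟨B, fun n => ?_⟩
  have := hB n
  simp only [birkhoffSum, Finset.sum_sub_distrib, Finset.sum_const, Finset.card_range,
    nsmul_eq_mul] at this ⊢
  linarith

/-- **Pointwise ergodic theorem** for ergodic probability-preserving maps. -/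
theorem tendsto_birkhoffSum_div {T : α → α} (hT : Ergodic T μ)
    {f : α → ℝ} (hfm : Measurable f) (hf : Integrable f μ) :
    ∀ᵐ x ∂μ, Tendsto (fun n : ℕ => birkhoffSum T f n x / n) atTop (𝓝 (∫ x, f x ∂μ)) := by
  have hup : ∀ k : ℕ, ∀ᵐ x ∂μ, ∃ B, ∀ n : ℕ,
      birkhoffSum T f n x ≤ B + n * (∫ x, f x ∂μ + 1 / ((k : ℝ) + 1)) := fun k =>
    birkhoffSum_le_of_integral_lt hT hfm hf (by linarith [Nat.one_div_pos_of_nat (α := ℝ) (n := k)])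
  have hlo : ∀ k : ℕ, ∀ᵐ x ∂μ, ∃ B, ∀ n : ℕ,
      birkhoffSum T (fun x => -f x) n x ≤ B + n * (-∫ x, f x ∂μ + 1 / ((k : ℝ) + 1)) := fun k =>
    birkhoffSum_le_of_integral_lt hT hfm.neg hf.neg (by
      rw [integral_neg']; linarith [Nat.one_div_pos_of_nat (α := ℝ) (n := k)])
  filter_upwards [ae_all_iff.2 hup, ae_all_iff.2 hlo] with x hxu hxl
  rw [Metric.tendsto_atTop]
  intro ε hε
  obtain ⟨k, hk⟩ := exists_nat_one_div_lt (half_pos hε)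
  obtain ⟨B, hB⟩ := hxu k
  obtain ⟨B', hB'⟩ := hxl k
  obtain ⟨N, hN⟩ := exists_nat_gt ((|B| + |B'|) / (ε / 2))
  refine ⟨N + 1, fun n hn => ?_⟩
  have hn0 : (0 : ℝ) < n := by exact_mod_cast (by omega : 0 < n)
  have hNn : (N : ℝ) ≤ n := by exact_mod_cast (by omega : N ≤ n)
  have h1 : |B| + |B'| < n * (ε / 2) := by
    rw [div_lt_iff₀ (half_pos hε)] at hN
    nlinarith
  have h2 := hB n
  have h3 := hB' n
  have h4 : birkhoffSum T (fun x => -f x) n x = -birkhoffSum T f n x := by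
    simp [birkhoffSum]
  rw [h4] at h3
  have h5 := le_abs_self B
  have h6 := le_abs_self B'
  have h7 := abs_nonneg B
  have h8 := abs_nonneg B'
  have h9 : n * (1 / ((k : ℝ) + 1)) < n * (ε / 2) := mul_lt_mul_of_pos_left hk hn0
  rw [Real.dist_eq, abs_lt]
  constructor
  · rw [lt_sub_iff_add_lt, lt_div_iff₀ hn0]
    nlinarith
  · rw [sub_lt_iff_lt_add, div_lt_iff₀ hn0]
    nlinarith

end Birkhoff

section Probability

variable {Ω : Type*}

/-- Along a sequence with bounded increments, convergence of averages along squares suffices. -/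
lemma tendsto_div_of_tendsto_sq {S : ℕ → ℝ} {C : ℝ} (hinc : ∀ n, |S (n + 1) - S n| ≤ C)
    (h : Tendsto (fun n : ℕ => S ((n + 1) ^ 2) / ((n : ℝ) + 1) ^ 2) atTop (𝓝 0)) :
    Tendsto (fun n : ℕ => S n / n) atTop (𝓝 0) := by
  have hC : 0 ≤ C := (abs_nonneg _).trans (hinc 0)
  have hdiff : ∀ m k : ℕ, |S (m + k) - S m| ≤ k * C := by
    intro m k
    induction k with
    | zero => simp
    | succ k ih =>
      have h1 := hinc (m + k)
      have h2 := abs_add_le (S (m + k + 1) - S (m + k)) (S (m + k) - S m)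
      rw [sub_add_sub_cancel] at h2
      rw [← add_assoc]
      push_cast
      linarith
  have hsq : Tendsto (fun n : ℕ => |S (n ^ 2) / (n : ℝ) ^ 2|) atTop (𝓝 0) := by
    rw [← tendsto_add_atTop_iff_nat 1]
    simpa using h.abs
  have hsqrt : Tendsto Nat.sqrt atTop atTop := by
    refine tendsto_atTop_mono' atTop (f₁ := Nat.sqrt) ?_ ?_
    · exact Eventually.of_forall fun _ => le_rfl
    · refine tendsto_atTop_atTop.2 fun b => ⟨b * b, fun a ha => Nat.le_sqrt.2 ha⟩
  have hb : Tendsto (fun m : ℕ => |S ((Nat.sqrt m) ^ 2) / ((Nat.sqrt m : ℕ) : ℝ) ^ 2| +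
      2 * C / ((Nat.sqrt m : ℕ) : ℝ)) atTop (𝓝 0) := by
    have h2 : Tendsto (fun n : ℕ => 2 * C / (n : ℝ)) atTop (𝓝 0) :=
      tendsto_const_div_atTop_nhds_zero_nat _
    simpa using (hsq.comp hsqrt).add (h2.comp hsqrt)
  refine squeeze_zero_norm' ?_ hb
  filter_upwards [eventually_ge_atTop 1] with m hm
  set n := Nat.sqrt m with hn
  have hn1 : 1 ≤ n := Nat.le_sqrt.2 (by simpa using hm)
  have hnm : n ^ 2 ≤ m := by rw [pow_two]; exact Nat.sqrt_le m
  have hmn : m ≤ n ^ 2 + 2 * n := by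
    have := Nat.sqrt_le_add m
    rw [← hn] at this
    nlinarith
  obtain ⟨k, hk⟩ := Nat.exists_eq_add_of_le hnm
  have hk2 : (k : ℝ) ≤ 2 * n := by exact_mod_cast (by omega : k ≤ 2 * n)
  have hd := hdiff (n ^ 2) k
  rw [← hk] at hd
  have hnp : (0 : ℝ) < n := by exact_mod_cast hn1
  have hmp : (n : ℝ) ^ 2 ≤ m := by exact_mod_cast hnm
  have hSm : |S m| ≤ |S (n ^ 2)| + 2 * n * C := by
    have h1 := abs_add_le (S m - S (n ^ 2)) (S (n ^ 2))
    rw [sub_add_cancel] at h1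
    nlinarith
  rw [Real.norm_eq_abs, abs_div, abs_div, abs_of_pos (a := (m : ℝ)) (by nlinarith),
    abs_of_pos (a := (n : ℝ) ^ 2) (by positivity)]
  calc |S m| / m ≤ (|S (n ^ 2)| + 2 * n * C) / (n : ℝ) ^ 2 := by gcongr
    _ = _ := by field_simp

variable {m0 : MeasurableSpace Ω} {μ : Measure Ω} [IsProbabilityMeasure μ]

/-- Strong law of large numbers for uniformly bounded orthogonal random variables. -/
theorem tendsto_average_of_orthogonal {D : ℕ → Ω → ℝ} {C : ℝ} (hDm : ∀ n, Measurable (D n))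
    (hDb : ∀ n ω, |D n ω| ≤ C) (horth : ∀ i j, i < j → ∫ ω, D i ω * D j ω ∂μ = 0) :
    ∀ᵐ ω ∂μ, Tendsto (fun n : ℕ => (∑ j ∈ Finset.range n, D j ω) / n) atTop (𝓝 0) := by
  have hinteg : ∀ i j, Integrable (fun ω => D i ω * D j ω) μ := fun i j => by
    refine Integrable.of_bound ((hDm i).mul (hDm j)).aestronglyMeasurable (C * C)
      (ae_of_all _ fun ω => ?_)
    rw [norm_mul]
    exact mul_le_mul (hDb i ω) (hDb j ω) (norm_nonneg _) ((abs_nonneg _).trans (hDb i ω))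
  have hsym : ∀ i j, i ≠ j → ∫ ω, D i ω * D j ω ∂μ = 0 := by
    intro i j hij
    rcases lt_or_gt_of_ne hij with h | h
    · exact horth i j h
    · simpa only [mul_comm] using horth j i h
  have hSm : ∀ n, Measurable fun ω => ∑ j ∈ Finset.range n, D j ω := fun n =>
    Finset.measurable_fun_sum _ fun j _ => hDm j
  have hsec : ∀ n : ℕ, ∫ ω, (∑ j ∈ Finset.range n, D j ω) ^ 2 ∂μ ≤ n * C ^ 2 := by
    intro n
    have e : ∀ ω, (∑ j ∈ Finset.range n, D j ω) ^ 2 =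
        ∑ i ∈ Finset.range n, ∑ j ∈ Finset.range n, D i ω * D j ω := fun ω => by
      rw [pow_two, Finset.sum_mul_sum]
    simp_rw [e]
    rw [integral_finsetSum _ fun i _ => integrable_finsetSum _ fun j _ => hinteg i j]
    calc ∑ i ∈ Finset.range n, ∫ ω, ∑ j ∈ Finset.range n, D i ω * D j ω ∂μ
        ≤ ∑ i ∈ Finset.range n, C ^ 2 := by
          refine Finset.sum_le_sum fun i hi => ?_
          rw [integral_finsetSum _ fun j _ => hinteg i j,
            Finset.sum_eq_single_of_mem i hi fun j _ hj => hsym i j hj.symm]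
          calc ∫ ω, D i ω * D i ω ∂μ ≤ ∫ _, C ^ 2 ∂μ := by
                refine integral_mono (hinteg i i) (integrable_const _) fun ω => ?_
                have := hDb i ω
                simp only
                rw [← pow_two, ← sq_abs]
                exact pow_le_pow_left₀ (abs_nonneg _) this 2
            _ = C ^ 2 := by simp
      _ = n * C ^ 2 := by simp
  set g : ℕ → Ω → ℝ := fun n ω =>
    ((∑ j ∈ Finset.range ((n + 1) ^ 2), D j ω) / ((n : ℝ) + 1) ^ 2) ^ 2 with hg
  have hgm : ∀ n, Measurable (g n) := fun n => ((hSm _).div_const _).pow_const 2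
  have hgl : ∀ n, ∫⁻ ω, ENNReal.ofReal (g n ω) ∂μ ≤ ENNReal.ofReal (C ^ 2 / ((n : ℝ) + 1) ^ 2) := by
    intro n
    have hn : (0 : ℝ) < (n : ℝ) + 1 := by positivity
    have hgi : Integrable (g n) μ := by
      have e : g n = fun ω => (∑ i ∈ Finset.range ((n + 1) ^ 2),
          ∑ j ∈ Finset.range ((n + 1) ^ 2), D i ω * D j ω) / (((n : ℝ) + 1) ^ 2) ^ 2 := by
        funext ω
        rw [hg]
        simp only
        rw [div_pow, ← Finset.sum_mul_sum, pow_two (∑ j ∈ Finset.range ((n + 1) ^ 2), D j ω)]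
      rw [e]
      exact (integrable_finsetSum _ fun i _ => integrable_finsetSum _ fun j _ => hinteg i j).div_const _
    rw [← ofReal_integral_eq_lintegral_ofReal hgi (ae_of_all _ fun ω => sq_nonneg _)]
    refine ENNReal.ofReal_le_ofReal ?_
    simp only [hg, div_pow]
    rw [integral_div, div_le_div_iff₀ (by positivity) (by positivity)]
    have := hsec ((n + 1) ^ 2)
    push_cast at this
    nlinarith [pow_pos hn 2]
  have hsum : Summable fun n : ℕ => C ^ 2 / ((n : ℝ) + 1) ^ 2 := by
    have h1 : Summable fun n : ℕ => 1 / ((n : ℝ)) ^ 2 := Real.summable_one_div_nat_pow.2 one_lt_two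
    have h2 := ((summable_nat_add_iff 1).2 h1).mul_left (C ^ 2)
    refine h2.congr fun n => ?_
    push_cast
    ring
  have hfin : ∫⁻ ω, ∑' n, ENNReal.ofReal (g n ω) ∂μ ≠ ∞ := by
    rw [lintegral_tsum fun n => (hgm n).ennreal_ofReal.aemeasurable]
    refine ne_top_of_le_ne_top ?_ (ENNReal.tsum_le_tsum hgl)
    rw [← ENNReal.ofReal_tsum_of_nonneg (fun n => by positivity) hsum]
    exact ENNReal.ofReal_ne_top
  filter_upwards [ae_lt_top (Measurable.tsum fun n => (hgm n).ennreal_ofReal) hfin]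
    with ω hω
  refine tendsto_div_of_tendsto_sq (S := fun n => ∑ j ∈ Finset.range n, D j ω) (C := C) ?_ ?_
  · intro n
    simp only [Finset.sum_range_succ, add_sub_cancel_left]
    exact hDb n ω
  · have h1 := ENNReal.tendsto_atTop_zero_of_tsum_ne_top hω.ne
    have h2 := (ENNReal.tendsto_toReal ENNReal.zero_ne_top).comp h1
    have h3 : Tendsto (fun n => g n ω) atTop (𝓝 0) := by
      refine h2.congr fun n => ?_
      simp only [Function.comp]
      rw [ENNReal.toReal_ofReal (sq_nonneg _)]
    have h4 := (Real.continuous_sqrt.tendsto 0).comp h3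
    rw [Real.sqrt_zero] at h4
    rw [tendsto_zero_iff_abs_tendsto_zero]
    refine h4.congr fun n => ?_
    simp only [Function.comp, hg]
    rw [Real.sqrt_sq_eq_abs]

/-- **Hunt's lemma**: conditional expectations of a bounded almost surely convergent sequence
along a filtration converge to the limit, if the latter is measurable with respect to the limit
σ-algebra. -/
theorem tendsto_condExp_of_tendsto_of_bounded (ℱ : Filtration ℕ m0) {Z : ℕ → Ω → ℝ}
    {Zlim : Ω → ℝ} {C : ℝ} (hZm : ∀ n, Measurable (Z n)) (hZb : ∀ n ω, |Z n ω| ≤ C)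
    (hZlm : Measurable Zlim) (hZlb : ∀ ω, |Zlim ω| ≤ C)
    (hZl : AEStronglyMeasurable[⨆ n, ℱ n] Zlim μ)
    (hlim : ∀ᵐ ω ∂μ, Tendsto (fun n => Z n ω) atTop (𝓝 (Zlim ω))) :
    ∀ᵐ ω ∂μ, Tendsto (fun n => (μ[Z n|ℱ n]) ω) atTop (𝓝 (Zlim ω)) := by
  have hsup : (⨆ n, ℱ n : MeasurableSpace Ω) ≤ m0 := iSup_le ℱ.le
  have hYb : ∀ n ω, |Z n ω - Zlim ω| ≤ 2 * C := fun n ω => by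
    have := abs_sub (Z n ω) (Zlim ω)
    linarith [hZb n ω, hZlb ω]
  have hZi : ∀ n, Integrable (Z n) μ := fun n =>
    Integrable.of_bound (hZm n).aestronglyMeasurable C (ae_of_all _ (hZb n))
  have hZli : Integrable Zlim μ :=
    Integrable.of_bound hZlm.aestronglyMeasurable C (ae_of_all _ hZlb)
  set W : ℕ → Ω → ℝ := fun N ω => ⨆ m : ℕ, |Z (N + m) ω - Zlim ω| with hW
  have hbdd : ∀ N ω, BddAbove (range fun m : ℕ => |Z (N + m) ω - Zlim ω|) := fun N ω =>
    ⟨2 * C, by rintro _ ⟨m, rfl⟩; exact hYb _ _⟩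
  have hWm : ∀ N, Measurable (W N) := fun N =>
    Measurable.iSup fun m => ((hZm _).sub hZlm).abs
  have hW0 : ∀ N ω, 0 ≤ W N ω := fun N ω =>
    (abs_nonneg _).trans (le_ciSup (hbdd N ω) 0)
  have hWC : ∀ N ω, W N ω ≤ 2 * C := fun N ω => ciSup_le fun m => hYb _ _
  have hWi : ∀ N, Integrable (W N) μ := fun N =>
    Integrable.of_bound (hWm N).aestronglyMeasurable (2 * C) (ae_of_all _ fun ω => by
      rw [Real.norm_eq_abs, abs_of_nonneg (hW0 N ω)]; exact hWC N ω)
  have hYW : ∀ N n, N ≤ n → ∀ ω, |Z n ω - Zlim ω| ≤ W N ω := by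
    intro N n hNn ω
    obtain ⟨m, rfl⟩ := Nat.exists_eq_add_of_le hNn
    exact le_ciSup (hbdd N ω) m
  have hWlim : ∀ᵐ ω ∂μ, Tendsto (fun N => W N ω) atTop (𝓝 0) := by
    filter_upwards [hlim] with ω hω
    rw [Metric.tendsto_atTop] at hω ⊢
    intro ε hε
    obtain ⟨N, hN⟩ := hω (ε / 2) (half_pos hε)
    refine ⟨N, fun n hn => ?_⟩
    rw [Real.dist_eq, sub_zero, abs_of_nonneg (hW0 n ω)]
    refine lt_of_le_of_lt (ciSup_le fun m => ?_) (half_lt_self hε)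
    exact (hN (n + m) (by omega)).le
  have hWint : Tendsto (fun N => ∫ ω, W N ω ∂μ) atTop (𝓝 0) := by
    have := tendsto_integral_of_dominated_convergence (μ := μ) (F := W) (f := fun _ => 0)
      (fun _ => 2 * C) (fun N => (hWm N).aestronglyMeasurable) (integrable_const _)
      (fun N => ae_of_all _ fun ω => by
        rw [Real.norm_eq_abs, abs_of_nonneg (hW0 N ω)]; exact hWC N ω) hWlim
    simpa using this
  set V : ℕ → Ω → ℝ := fun N => μ[W N|⨆ n, ℱ n] with hV
  have hV0 : ∀ N, 0 ≤ᵐ[μ] V N := fun N => condExp_nonneg (ae_of_all _ (hW0 N))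
  have hVsmall : ∀ k : ℕ, ∀ᵐ ω ∂μ, ∃ N, V N ω < 1 / ((k : ℝ) + 1) := by
    intro k
    have hk : (0 : ℝ) < 1 / ((k : ℝ) + 1) := Nat.one_div_pos_of_nat
    have hle : ∀ N, μ.real {ω | ¬ ∃ N, V N ω < 1 / ((k : ℝ) + 1)} ≤
        ((k : ℝ) + 1) * ∫ ω, W N ω ∂μ := by
      intro N
      have h1 := mul_meas_ge_le_integral_of_nonneg (hV0 N) integrable_condExp (1 / ((k : ℝ) + 1))
      have h2 : ∫ ω, V N ω ∂μ = ∫ ω, W N ω ∂μ := integral_condExp hsup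
      have h3 : μ.real {ω | ¬ ∃ N, V N ω < 1 / ((k : ℝ) + 1)} ≤
          μ.real {ω | 1 / ((k : ℝ) + 1) ≤ V N ω} := by
        refine measureReal_mono fun ω hω => ?_
        simp only [not_exists, not_lt, mem_ofPred_eq] at hω ⊢
        exact hω N
      rw [h2, one_div_mul_eq_div, div_le_iff₀' (by positivity)] at h1
      exact h3.trans h1
    have h0 : μ.real {ω | ¬ ∃ N, V N ω < 1 / ((k : ℝ) + 1)} ≤ 0 := by
      refine ge_of_tendsto' (x := atTop) ?_ hle
      simpa using hWint.const_mul ((k : ℝ) + 1)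
    have h1 : μ.real {ω | ¬ ∃ N, V N ω < 1 / ((k : ℝ) + 1)} = 0 :=
      le_antisymm h0 measureReal_nonneg
    rw [measureReal_eq_zero_iff] at h1
    exact h1
  have hVlim : ∀ᵐ ω ∂μ, ∀ N, Tendsto (fun n => (μ[W N|ℱ n]) ω) atTop (𝓝 (V N ω)) :=
    ae_all_iff.2 fun N => tendsto_ae_condExp (W N)
  have hZlim : ∀ᵐ ω ∂μ, Tendsto (fun n => (μ[Zlim|ℱ n]) ω) atTop (𝓝 (Zlim ω)) := by
    filter_upwards [tendsto_ae_condExp (ℱ := ℱ) Zlim,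
      condExp_of_aestronglyMeasurable' hsup hZl hZli] with ω h1 h2
    rwa [h2] at h1
  have hdom : ∀ᵐ ω ∂μ, ∀ N n, N ≤ n → |(μ[Z n|ℱ n]) ω - (μ[Zlim|ℱ n]) ω| ≤ (μ[W N|ℱ n]) ω := by
    refine ae_all_iff.2 fun N => ae_all_iff.2 fun n => ?_
    by_cases hNn : N ≤ n
    · have hlow : μ[Z n - Zlim|ℱ n] ≤ᵐ[μ] μ[W N|ℱ n] :=
        condExp_mono ((hZi n).sub hZli) (hWi N) (ae_of_all _ fun ω =>
          (le_abs_self _).trans (hYW N n hNn ω))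
      have hup : μ[Zlim - Z n|ℱ n] ≤ᵐ[μ] μ[W N|ℱ n] :=
        condExp_mono (hZli.sub (hZi n)) (hWi N) (ae_of_all _ fun ω => by
          have := hYW N n hNn ω
          rw [abs_sub_comm] at this
          exact (le_abs_self _).trans this)
      filter_upwards [hlow, hup, condExp_sub (hZi n) hZli (ℱ n), condExp_sub hZli (hZi n) (ℱ n)]
        with ω h1 h2 h3 h4 _
      rw [h3, Pi.sub_apply] at h1
      rw [h4, Pi.sub_apply] at h2
      exact abs_le.2 ⟨by linarith, h1⟩
    · exact ae_of_all _ fun ω h => absurd h hNn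
  filter_upwards [hVlim, hZlim, hdom, ae_all_iff.2 hVsmall] with ω h1 h2 h3 h4
  have h5 : Tendsto (fun n => (μ[Z n|ℱ n]) ω - (μ[Zlim|ℱ n]) ω) atTop (𝓝 0) := by
    rw [Metric.tendsto_atTop]
    intro ε hε
    obtain ⟨k, hk⟩ := exists_nat_one_div_lt hε
    obtain ⟨N, hN⟩ := h4 k
    obtain ⟨n0, hn0⟩ := eventually_atTop.1 ((h1 N).eventually_lt_const (hN.trans hk))
    refine ⟨max N n0, fun n hn => ?_⟩
    rw [Real.dist_eq, sub_zero]
    exact (h3 N n (le_of_max_le_left hn)).trans_lt (hn0 n (le_of_max_le_right hn))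
  simpa using h5.add h2

/-- On a standard Borel space, an arbitrary set with null preimage under a measurable map is null
for the image measure. -/
lemma map_eq_zero_of_preimage_eq_zero [StandardBorelSpace Ω] {S : Type*} [MeasurableSpace S]
    {X : Ω → S} (hX : Measurable X) [StandardBorelSpace S] {A : Set S}
    (hA : μ (X ⁻¹' A) = 0) : μ.map X A = 0 := by
  have : Nonempty Ω := μ.nonempty_of_neZero
  obtain ⟨N, hAN, hNm, hN⟩ := exists_measurable_superset_of_null hA
  set ρ : Measure (S × Ω) := μ.map fun ω => (X ω, ω) with hρ
  have hpair : Measurable fun ω => (X ω, ω) := hX.prodMk measurable_id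
  have : IsProbabilityMeasure ρ := Measure.isProbabilityMeasure_map hpair.aemeasurable
  have hgm : MeasurableSet {p : S × Ω | p.1 = X p.2 ∧ p.2 ∉ N} := by
    refine MeasurableSet.inter ?_ (measurable_snd hNm.compl)
    exact measurableSet_eq_fun measurable_fst (hX.comp measurable_snd)
  have hgood : ∀ᵐ p ∂ρ, p.1 = X p.2 ∧ p.2 ∉ N := by
    rw [hρ, ae_map_iff hpair.aemeasurable hgm]
    filter_upwards [measure_eq_zero_iff_ae_notMem.1 hN] with ω hω
    exact ⟨rfl, hω⟩
  rw [← ρ.disintegrate ρ.condKernel] at hgood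
  have h2 := Measure.ae_ae_of_ae_compProd hgood
  have hfst : ρ.fst = μ.map X := by
    exact Measure.fst_map_prodMk measurable_id
  rw [hfst] at h2
  refine measure_eq_zero_iff_ae_notMem.2 ?_
  filter_upwards [h2] with a ha haA
  obtain ⟨ω, h3, h4⟩ := ha.exists
  exact h4 (hAN (show X ω ∈ A from h3 ▸ haA))

end Probability

section Deterministic

variable {𝒳 : Type*}

/-- All the recurrence times used in the definition of `zeta` are finite. -/
def IsRecurrent (l : ℕ → ℕ) (ω : Path 𝒳) : Prop :=
  ∀ n, ∃ t : ℕ, 0 < t ∧ ∀ s < l (n + 1),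
    ω (zeta l ω n - (s : ℤ) + (t : ℤ)) = ω (zeta l ω n - (s : ℤ))

/-- The standing assumptions on the block lengths `l`. -/
structure BlockLengths (l : ℕ → ℕ) : Prop where
  mono : Monotone l
  le_self : ∀ k, 1 ≤ k → l k ≤ k
  tendsto : Tendsto l atTop atTop

/-- Two paths agree on the time interval `[0, t]`. -/
def AgreeUpTo (t : ℤ) (ω ω' : Path 𝒳) : Prop := ∀ i : ℤ, 0 ≤ i → i ≤ t → ω i = ω' i

lemma AgreeUpTo.symm {t : ℤ} {ω ω' : Path 𝒳} (h : AgreeUpTo t ω ω') : AgreeUpTo t ω' ω :=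
  fun i h0 h1 => (h i h0 h1).symm

lemma AgreeUpTo.mono {s t : ℤ} {ω ω' : Path 𝒳} (h : AgreeUpTo t ω ω') (hst : s ≤ t) :
    AgreeUpTo s ω ω' :=
  fun i h0 h1 => h i h0 (h1.trans hst)

lemma sInf_eq_sInf_of_forall_le {S S' : Set ℕ} (hS : S.Nonempty)
    (h : ∀ v ≤ sInf S, (v ∈ S ↔ v ∈ S')) : sInf S' = sInf S := by
  have h1 : sInf S ∈ S' := (h _ le_rfl).1 (Nat.sInf_mem hS)
  refine le_antisymm (Nat.sInf_le h1) ?_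
  by_contra! hlt
  exact Nat.notMem_of_lt_sInf hlt ((h _ hlt.le).2 (Nat.sInf_mem ⟨_, h1⟩))

variable {l : ℕ → ℕ} {ω ω' : Path 𝒳}

lemma IsRecurrent.exists_zeta_succ (hω : IsRecurrent l ω) (n : ℕ) :
    ∃ t : ℕ, 0 < t ∧ zeta l ω (n + 1) = zeta l ω n + t ∧
      ∀ s < l (n + 1), ω (zeta l ω n - (s : ℤ) + (t : ℤ)) = ω (zeta l ω n - (s : ℤ)) := by
  have h := Nat.sInf_mem (hω n)
  exact ⟨_, h.1, rfl, h.2⟩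

lemma IsRecurrent.zeta_lt_succ (hω : IsRecurrent l ω) (n : ℕ) :
    zeta l ω n < zeta l ω (n + 1) := by
  obtain ⟨t, h0, h1, -⟩ := hω.exists_zeta_succ n
  omega

lemma IsRecurrent.zeta_strictMono (hω : IsRecurrent l ω) : StrictMono (zeta l ω) :=
  strictMono_nat_of_lt_succ hω.zeta_lt_succ

lemma IsRecurrent.le_zeta (hω : IsRecurrent l ω) (n : ℕ) : (n : ℤ) ≤ zeta l ω n := by
  induction n with
  | zero => exact le_rfl
  | succ n ih =>
    have := hω.zeta_lt_succ n
    push_cast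
    omega

lemma IsRecurrent.apply_zeta_sub (hl : Monotone l) (hω : IsRecurrent l ω) {j m : ℕ} (hjm : j ≤ m)
    {i : ℕ} (hi : i < l (j + 1)) : ω (zeta l ω m - (i : ℤ)) = ω (zeta l ω j - (i : ℤ)) := by
  induction m, hjm using Nat.le_induction with
  | base => rfl
  | succ m hm ih =>
    obtain ⟨t, -, h1, h2⟩ := hω.exists_zeta_succ m
    rw [← ih, ← h2 i (hi.trans_le (hl (by omega))), h1]
    congr 1
    ring

lemma BlockLengths.Jfun_mem (hl : BlockLengths l) (n : ℕ) :
    1 ≤ Jfun l n ∧ n < l (Jfun l n + 1) := by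
  refine Nat.sInf_mem (s := {j : ℕ | 1 ≤ j ∧ n < l (j + 1)}) ?_
  obtain ⟨a, ha⟩ := (hl.tendsto.eventually_gt_atTop n).exists_forall_of_atTop
  exact ⟨a + 1, by omega, ha _ (by omega)⟩

lemma BlockLengths.Jfun_mono (hl : BlockLengths l) : Monotone (Jfun l) := fun _ n hmn =>
  Nat.sInf_le ⟨(hl.Jfun_mem n).1, hmn.trans_lt (hl.Jfun_mem n).2⟩

lemma BlockLengths.le_Jfun (hl : BlockLengths l) (n : ℕ) : n ≤ Jfun l n := by
  have h1 := (hl.Jfun_mem n).2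
  have h2 := hl.le_self (Jfun l n + 1) (by omega)
  omega

lemma BlockLengths.lt_Jfun (hl : BlockLengths l) (j : ℕ) : j < Jfun l (l (j + 1)) := by
  have h1 := (hl.Jfun_mem (l (j + 1))).2
  by_contra! h
  exact absurd (hl.mono (by omega : Jfun l (l (j + 1)) + 1 ≤ j + 1)) (not_le.2 h1)

lemma IsRecurrent.tildePast_eq (hl : BlockLengths l) (hω : IsRecurrent l ω) {i m : ℕ}
    (hi : i < l (m + 1)) : tildePast l ω i = ω (zeta l ω m - (i : ℤ)) := by
  rcases le_total (Jfun l i) m with h | h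
  · exact (hω.apply_zeta_sub hl.mono h (hl.Jfun_mem i).2).symm
  · exact hω.apply_zeta_sub hl.mono h hi

lemma zeta_eq_of_agreeUpTo (hl : BlockLengths l) (hω : IsRecurrent l ω) {t : ℤ}
    (h : AgreeUpTo t ω ω') {n : ℕ} (hn : zeta l ω n ≤ t) : zeta l ω' n = zeta l ω n := by
  induction n with
  | zero => rfl
  | succ n ih =>
    have e := ih ((hω.zeta_lt_succ n).le.trans hn)
    have hz := hω.le_zeta n
    have hle := hl.le_self (n + 1) (by omega)
    simp only [zeta] at hn ⊢
    rw [e]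
    congr 2
    refine sInf_eq_sInf_of_forall_le (hω n) fun v hv => ?_
    have hv' : zeta l ω n + v ≤ t := by
      refine le_trans ?_ hn
      gcongr
    simp only [mem_ofPred_eq]
    refine and_congr Iff.rfl (forall₂_congr fun s hs => ?_)
    rw [h _ (by omega) (by omega), h _ (by omega) (by omega)]

lemma zeta_le_iff_of_agreeUpTo (hl : BlockLengths l) (hω : IsRecurrent l ω)
    (hω' : IsRecurrent l ω') {t : ℤ} (h : AgreeUpTo t ω ω') {v : ℤ} (hv : v ≤ t) (n : ℕ) :
    zeta l ω n ≤ v ↔ zeta l ω' n ≤ v :=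
  ⟨fun hn => (zeta_eq_of_agreeUpTo hl hω h (hn.trans hv)).trans_le hn,
    fun hn => (zeta_eq_of_agreeUpTo hl hω' h.symm (hn.trans hv)).trans_le hn⟩

lemma cnt_eq_of_agreeUpTo {n : ℤ} (h : AgreeUpTo n ω ω') {m : ℕ} {s s' : ℕ → 𝒳}
    (hs : ∀ j < m, s j = s' j) {a b : ℤ} (ha : (m : ℤ) - 1 ≤ a) (hb : b ≤ n) :
    cnt ω m s a b = cnt ω' m s' a b := by
  classical
  unfold cnt
  congr 1
  refine Finset.filter_congr fun t ht => ?_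
  rw [Finset.mem_Icc] at ht
  refine forall₂_congr fun j hj => ?_
  rw [h _ (by omega) (by omega), hs j hj]

lemma withLast_eq {m : ℕ} {s s' : ℕ → 𝒳} (hs : ∀ j < m, s j = s' j) (x : 𝒳) :
    ∀ j < m + 1, withLast x s j = withLast x s' j := by
  intro j hj
  unfold withLast
  split_ifs with h
  · rfl
  · exact hs _ (by omega)

lemma empCond_eq_of_agreeUpTo {n : ℕ} (h : AgreeUpTo n ω ω') {m : ℕ} {s s' : ℕ → 𝒳}
    (hs : ∀ j < m, s j = s' j) (x : 𝒳) : empCond ω n m x s = empCond ω' n m x s' := by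
  unfold empCond
  rw [cnt_eq_of_agreeUpTo h (withLast_eq hs x) (by push_cast; omega) le_rfl,
    cnt_eq_of_agreeUpTo h hs (by omega) (by omega)]

lemma inL_iff_of_agreeUpTo (γ : ℝ) {n : ℕ} (h : AgreeUpTo n ω ω') (m : ℕ) (s : ℕ → 𝒳) :
    inL γ ω n m s ↔ inL γ ω' n m s := by
  unfold inL inL2
  rw [cnt_eq_of_agreeUpTo (s' := s) h (fun _ _ => rfl) (by push_cast; omega) le_rfl]
  refine and_congr (exists_congr fun t => ?_) Iff.rfl
  refine and_congr_right fun h0 => and_congr_right fun h1 => forall₂_congr fun j hj => ?_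
  rw [h _ (by omega) (by unfold half at h1; omega)]

lemma hatDelta_eq_of_agreeUpTo (γ : ℝ) {n k : ℕ} (h : AgreeUpTo n ω ω')
    (hz : zeta l ω (Jfun l k) ≤ (half n : ℤ) - 1 ↔ zeta l ω' (Jfun l k) ≤ (half n : ℤ) - 1)
    (ht : zeta l ω (Jfun l k) ≤ (half n : ℤ) - 1 → ∀ i < k, tildePast l ω i = tildePast l ω' i) :
    hatDelta γ l ω n k = hatDelta γ l ω' n k := by
  unfold hatDelta
  by_cases hc : zeta l ω (Jfun l k) ≤ (half n : ℤ) - 1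
  · rw [if_pos hc, if_pos (hz.1 hc)]
    have ht := ht hc
    have hp : ∀ z, prependOld (tildePast l ω) k z = prependOld (tildePast l ω') k z := by
      intro z
      funext j
      unfold prependOld
      split_ifs with hj
      · exact ht j hj
      · rfl
    congr 2
    ext d
    simp only [mem_ofPred_eq]
    refine exists_congr fun i => and_congr_right fun _ => and_congr_right fun _ =>
      exists_congr fun z => exists_congr fun x => ?_
    rw [hp z, inL_iff_of_agreeUpTo γ h, empCond_eq_of_agreeUpTo h ht x,
      empCond_eq_of_agreeUpTo (s' := prependOld (tildePast l ω') k z) h (fun _ _ => rfl) x]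
  · rw [if_neg hc, if_neg (fun h' => hc (hz.2 h')), zero_mul, zero_mul]

lemma half_le (n : ℕ) : half n ≤ n := by unfold half; omega

lemma IsRecurrent.zeta_Jfun_le (hl : BlockLengths l) (hω : IsRecurrent l ω) {i k : ℕ}
    (hik : i ≤ k) : zeta l ω (Jfun l i) ≤ zeta l ω (Jfun l k) :=
  hω.zeta_strictMono.monotone (hl.Jfun_mono hik)

lemma tildePast_eq_of_agreeUpTo (hl : BlockLengths l) (hω : IsRecurrent l ω) {t : ℤ}
    (h : AgreeUpTo t ω ω') {i : ℕ} (hi : zeta l ω (Jfun l i) ≤ t) :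
    tildePast l ω i = tildePast l ω' i := by
  have h1 := hω.le_zeta (Jfun l i)
  have h2 := hl.le_Jfun i
  unfold tildePast
  rw [zeta_eq_of_agreeUpTo hl hω h hi, h _ (by omega) (by omega)]

lemma IsRecurrent.hatDelta_congr (hl : BlockLengths l) (hω : IsRecurrent l ω)
    (hω' : IsRecurrent l ω') (γ : ℝ) {n : ℕ} (h : AgreeUpTo n ω ω') (k : ℕ) :
    hatDelta γ l ω n k = hatDelta γ l ω' n k := by
  have hn := half_le n
  refine hatDelta_eq_of_agreeUpTo γ h
    (zeta_le_iff_of_agreeUpTo hl hω hω' h (by omega) _) fun hz i hi => ?_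
  have := hω.zeta_Jfun_le hl hi.le
  exact tildePast_eq_of_agreeUpTo hl hω h (by omega)

lemma chi_congr_of_hatDelta {β γ : ℝ} {n : ℕ}
    (h : ∀ k < n, hatDelta γ l ω n k = hatDelta γ l ω' n k) :
    chi β γ l ω n = chi β γ l ω' n := by
  unfold chi
  congr 1
  ext k
  simp only [mem_ofPred_eq]
  exact and_congr_right fun hk => by rw [h k hk]

lemma IsRecurrent.chi_congr (hl : BlockLengths l) (hω : IsRecurrent l ω)
    (hω' : IsRecurrent l ω') (β γ : ℝ) {n : ℕ} (h : AgreeUpTo n ω ω') :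
    chi β γ l ω n = chi β γ l ω' n :=
  chi_congr_of_hatDelta fun k _ => hω.hatDelta_congr hl hω' γ h k

lemma chi_mem (β γ : ℝ) (l : ℕ → ℕ) (ω : Path 𝒳) {n : ℕ} (hn : 1 ≤ n) :
    chi β γ l ω n < n ∧ hatDelta γ l ω n (chi β γ l ω n) ≤ (n : ℝ) ^ (-β) := by
  refine Nat.sInf_mem (s := {k : ℕ | k < n ∧ hatDelta γ l ω n k ≤ (n : ℝ) ^ (-β)})
    ⟨n - 1, by omega, ?_⟩
  have he : {d : ℝ | ∃ i : ℕ, 1 ≤ i ∧ i ≤ n ∧ ∃ z : ℕ → 𝒳, ∃ x : 𝒳,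
      inL γ ω n (n - 1 + i) (withLast x (prependOld (tildePast l ω) (n - 1) z)) ∧
      d = |empCond ω n (n - 1) x (tildePast l ω) -
            empCond ω n (n - 1 + i) x (prependOld (tildePast l ω) (n - 1) z)|} = ∅ := by
    refine eq_empty_of_forall_notMem ?_
    rintro d ⟨i, hi, -, z, x, ⟨⟨t, h1, h2, -⟩, -⟩, -⟩
    have := half_le n
    omega
  unfold hatDelta
  rw [he, Real.sSup_empty, mul_zero]
  positivity

lemma IsRecurrent.chi_le (hl : BlockLengths l) (hω : IsRecurrent l ω) (β γ : ℝ) {n j : ℕ}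
    (hn : 1 ≤ n) (hj : (n : ℤ) ≤ zeta l ω (j + 1)) : chi β γ l ω n ≤ l (j + 1) := by
  by_cases hlt : l (j + 1) < n
  · refine Nat.sInf_le ⟨hlt, ?_⟩
    have h1 := hω.zeta_strictMono.monotone (hl.lt_Jfun j)
    have h2 := half_le n
    unfold hatDelta
    rw [if_neg (by simp only [Nat.succ_eq_add_one] at h1; omega), zero_mul]
    positivity
  · have := (chi_mem β γ l ω hn).1
    omega

lemma lambda_nonneg (β γ : ℝ) (l : ℕ → ℕ) (ω : Path 𝒳) (n : ℕ) : 0 ≤ lambda β γ l ω n := by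
  induction n with
  | zero => exact le_rfl
  | succ n ih => simp only [lambda]; omega

lemma lambda_lt_succ (β γ : ℝ) (l : ℕ → ℕ) (ω : Path 𝒳) (n : ℕ) :
    lambda β γ l ω n < lambda β γ l ω (n + 1) := by
  simp only [lambda]; omega

lemma lambda_strictMono (β γ : ℝ) (l : ℕ → ℕ) (ω : Path 𝒳) : StrictMono (lambda β γ l ω) :=
  strictMono_nat_of_lt_succ (lambda_lt_succ β γ l ω)

lemma le_lambda (β γ : ℝ) (l : ℕ → ℕ) (ω : Path 𝒳) (n : ℕ) : (n : ℤ) ≤ lambda β γ l ω n := by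
  induction n with
  | zero => exact le_rfl
  | succ n ih =>
    have := lambda_lt_succ β γ l ω n
    push_cast
    omega

lemma IsRecurrent.jIndex_spec (hω : IsRecurrent l ω) {v : ℤ} (hv : 0 ≤ v) :
    zeta l ω (jIndex l ω v) ≤ v ∧ v < zeta l ω (jIndex l ω v + 1) := by
  have hne : {j : ℕ | v < zeta l ω (j + 1)}.Nonempty := by
    refine ⟨v.toNat, ?_⟩
    have := hω.le_zeta (v.toNat + 1)
    simp only [mem_ofPred_eq]
    push_cast at this
    omega
  refine ⟨?_, Nat.sInf_mem hne⟩
  rcases h : jIndex l ω v with _ | j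
  · exact hv
  · by_contra! hlt
    have : jIndex l ω v ≤ j := Nat.sInf_le hlt
    omega

/-- The set whose infimum determines the waiting time `λ_{n+1} - λ_n - 1`. -/
def waitSet (β γ : ℝ) (l : ℕ → ℕ) (ω : Path 𝒳) (v : ℤ) : Set ℕ :=
  {s : ℕ | ∀ r < chi β γ l ω (v + 1 + (s : ℤ)).toNat,
    ω (v + 1 + (s : ℤ) - (r : ℤ)) = ω (zeta l ω (jIndex l ω v) - (r : ℤ))}

lemma lambda_succ (β γ : ℝ) (l : ℕ → ℕ) (ω : Path 𝒳) (n : ℕ) :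
    lambda β γ l ω (n + 1) =
      lambda β γ l ω n + 1 + (sInf (waitSet β γ l ω (lambda β γ l ω n)) : ℕ) := rfl

lemma IsRecurrent.mem_waitSet (hl : BlockLengths l) (hω : IsRecurrent l ω) (β γ : ℝ) {v : ℤ}
    (hv : 0 ≤ v) :
    (zeta l ω (jIndex l ω v + 1) - (v + 1)).toNat ∈ waitSet β γ l ω v := by
  obtain ⟨h1, h2⟩ := hω.jIndex_spec hv
  set j := jIndex l ω v with hj
  have e : v + 1 + ((zeta l ω (j + 1) - (v + 1)).toNat : ℤ) = zeta l ω (j + 1) := by omega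
  intro r hr
  rw [e] at hr ⊢
  rw [← hj]
  refine hω.apply_zeta_sub hl.mono (Nat.le_succ j) (hr.trans_le ?_)
  exact hω.chi_le hl β γ (by omega) (by omega)

lemma IsRecurrent.lambda_succ_le (hl : BlockLengths l) (hω : IsRecurrent l ω) (β γ : ℝ) (n : ℕ) :
    lambda β γ l ω (n + 1) ≤ zeta l ω (jIndex l ω (lambda β γ l ω n) + 1) := by
  have hv := lambda_nonneg β γ l ω n
  have h1 := Nat.sInf_le (hω.mem_waitSet hl β γ hv)
  have h2 := (hω.jIndex_spec hv).2
  rw [lambda_succ]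
  omega

/-- At time `λ_{n+1}` the last `κ_{n+1}` symbols agree with the auxiliary process. -/
lemma IsRecurrent.apply_lambda_sub (hl : BlockLengths l) (hω : IsRecurrent l ω) (β γ : ℝ) (n : ℕ)
    {r : ℕ} (hr : r < kappa β γ l ω (n + 1)) :
    ω (lambda β γ l ω (n + 1) - (r : ℤ)) = tildePast l ω r := by
  have hv := lambda_nonneg β γ l ω n
  have h1 := Nat.sInf_mem ⟨_, hω.mem_waitSet hl β γ hv⟩
  have h2 := hω.lambda_succ_le hl β γ n
  have h3 := lambda_lt_succ β γ l ω n
  have h4 : kappa β γ l ω (n + 1) ≤ l (jIndex l ω (lambda β γ l ω n) + 1) :=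
    hω.chi_le hl β γ (by omega) (by omega)
  rw [hω.tildePast_eq hl (hr.trans_le h4)]
  exact h1 r hr

lemma IsRecurrent.jIndex_congr (hl : BlockLengths l) (hω : IsRecurrent l ω)
    (hω' : IsRecurrent l ω') {t v : ℤ} (h : AgreeUpTo t ω ω') (hv : v ≤ t) :
    jIndex l ω v = jIndex l ω' v := by
  unfold jIndex
  congr 1
  ext j
  have := zeta_le_iff_of_agreeUpTo hl hω hω' h hv (j + 1)
  simp only [mem_ofPred_eq]
  omega

lemma IsRecurrent.lambda_congr (hl : BlockLengths l) (hω : IsRecurrent l ω)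
    (hω' : IsRecurrent l ω') (β γ : ℝ) {t : ℤ} (h : AgreeUpTo t ω ω') {n : ℕ}
    (hn : lambda β γ l ω n ≤ t) : lambda β γ l ω' n = lambda β γ l ω n := by
  induction n with
  | zero => rfl
  | succ n ih =>
    have hlt := lambda_lt_succ β γ l ω n
    have e := ih (by omega)
    have hv := lambda_nonneg β γ l ω n
    have hup := hω.lambda_succ_le hl β γ n
    obtain ⟨hj1, hj2⟩ := hω.jIndex_spec hv
    have hjc := hω.jIndex_congr hl hω' h (v := lambda β γ l ω n) (by omega)
    have hne := hω.mem_waitSet hl β γ hv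
    rw [lambda_succ] at hn hup
    rw [lambda_succ, lambda_succ, e]
    set v := lambda β γ l ω n with hvdef
    congr 2
    refine sInf_eq_sInf_of_forall_le ⟨_, hne⟩ fun s hs => ?_
    have hst : v + 1 + (s : ℤ) ≤ t := by omega
    have hN : ((v + 1 + (s : ℤ)).toNat : ℤ) = v + 1 + s := by omega
    have hN1 : 1 ≤ (v + 1 + (s : ℤ)).toNat := by omega
    have hchi := hω.chi_congr hl hω' β γ (n := (v + 1 + (s : ℤ)).toNat)
      (h.mono (by omega))
    have hchi_lt := (chi_mem β γ l ω hN1).1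
    have hchi_le : chi β γ l ω (v + 1 + (s : ℤ)).toNat ≤ l (jIndex l ω v + 1) :=
      hω.chi_le hl β γ hN1 (by omega)
    have hle := hl.le_self (jIndex l ω v + 1) (by omega)
    have hjz := hω.le_zeta (jIndex l ω v)
    have hze := zeta_eq_of_agreeUpTo hl hω h (n := jIndex l ω v) (by omega)
    unfold waitSet
    simp only [mem_ofPred_eq]
    rw [← hchi, ← hjc, hze]
    refine forall₂_congr fun r hr => ?_
    rw [h _ (by omega) (by omega), h _ (by omega) (by omega)]

end Deterministic

section Measurability

lemma measurable_of_factors {α β' ι : Type*} [MeasurableSpace α] [MeasurableSpace β']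
    [MeasurableSpace ι] [Countable ι] [MeasurableSingletonClass ι] {h : α → ι}
    (hh : Measurable h) {g : α → β'} (hg : ∀ a b, h a = h b → g a = g b) : Measurable g := by
  intro s _
  have : g ⁻¹' s = h ⁻¹' (h '' (g ⁻¹' s)) := by
    refine (subset_preimage_image _ _).antisymm ?_
    rintro a ⟨b, hb, hab⟩
    simpa only [mem_preimage, hg a b hab.symm] using hb
  rw [this]
  exact hh (to_countable _).measurableSet

lemma measurableSet_forall {α ι : Type*} [MeasurableSpace α] [Countable ι] {p : ι → α → Prop}
    (hp : ∀ i, MeasurableSet {a | p i a}) : MeasurableSet {a | ∀ i, p i a} := by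
  have : {a | ∀ i, p i a} = ⋂ i, {a | p i a} := by ext; simp
  rw [this]
  exact MeasurableSet.iInter hp

lemma measurable_sInf_nat {α : Type*} [MeasurableSpace α] {p : α → Set ℕ}
    (hp : ∀ n, MeasurableSet {a | n ∈ p a}) : Measurable fun a => sInf (p a) := by
  refine measurable_to_countable' fun k => ?_
  have : (fun a => sInf (p a)) ⁻¹' {k} =
      ({a | k ∈ p a} ∩ ⋂ j : ℕ, {a | j < k → j ∉ p a}) ∪
        {a | k = 0 ∧ ∀ j, j ∉ p a} := by
    ext a
    simp only [mem_preimage, mem_singleton_iff, mem_union, mem_inter_iff, mem_iInter,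
      mem_ofPred_eq]
    constructor
    · rintro rfl
      rcases (p a).eq_empty_or_nonempty with h | h
      · right; simp [h]
      · exact Or.inl ⟨Nat.sInf_mem h, fun j hj => Nat.notMem_of_lt_sInf hj⟩
    · rintro (⟨h, h'⟩ | ⟨rfl, h⟩)
      · exact le_antisymm (Nat.sInf_le h)
          (not_lt.1 fun hlt => h' _ hlt (Nat.sInf_mem ⟨_, h⟩))
      · rw [eq_empty_of_forall_notMem h, Nat.sInf_empty]
  rw [this]
  refine ((hp k).inter (MeasurableSet.iInter fun j => ?_)).union ?_
  · exact (MeasurableSet.const (j < k)).imp (hp j).compl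
  · exact (MeasurableSet.const (k = 0)).inter (measurableSet_forall fun j => (hp j).compl)

lemma measurable_apply_countable {α β' ι : Type*} [MeasurableSpace α] [MeasurableSpace β']
    [MeasurableSpace ι] [Countable ι] [MeasurableSingletonClass ι] {τ : α → ι}
    (hτ : Measurable τ) {g : ι → α → β'} (hg : ∀ i, Measurable (g i)) :
    Measurable fun a => g (τ a) a := by
  intro s hs
  have : (fun a => g (τ a) a) ⁻¹' s = ⋃ i, τ ⁻¹' {i} ∩ g i ⁻¹' s := by
    ext a; simp
  rw [this]
  exact MeasurableSet.iUnion fun i => (hτ (measurableSet_singleton i)).inter (hg i hs)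

variable {l : ℕ → ℕ}

lemma measurable_past : Measurable (past : Path 𝒳 → ℕ → 𝒳) :=
  measurable_pi_iff.2 fun _ => measurable_pi_apply _

/-- The shift by an arbitrary integer time. -/
def shiftBy (t : ℤ) (ω : Path 𝒳) : Path 𝒳 := fun i => ω (i + t)

lemma measurable_shiftBy (t : ℤ) : Measurable (shiftBy t : Path 𝒳 → Path 𝒳) :=
  measurable_pi_iff.2 fun _ => measurable_pi_apply _

lemma measurable_eval {τ : Path 𝒳 → ℤ} (hτ : Measurable τ) : Measurable fun ω : Path 𝒳 => ω (τ ω) :=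
  measurable_apply_countable (g := fun i (ω : Path 𝒳) => ω i) hτ fun i => measurable_pi_apply i

lemma measurable_shiftBy_comp {τ : Path 𝒳 → ℤ} (hτ : Measurable τ) :
    Measurable fun ω => shiftBy (τ ω) ω :=
  measurable_apply_countable (g := shiftBy) hτ measurable_shiftBy

variable [Countable 𝒳] [MeasurableSingletonClass 𝒳]

lemma measurableSet_eval_eq {τ σ : Path 𝒳 → ℤ} (hτ : Measurable τ) (hσ : Measurable σ) :
    MeasurableSet {ω : Path 𝒳 | ω (τ ω) = ω (σ ω)} :=
  measurableSet_eq_fun (measurable_eval hτ) (measurable_eval hσ)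

lemma measurable_zeta (n : ℕ) : Measurable fun ω : Path 𝒳 => zeta l ω n := by
  induction n with
  | zero => exact measurable_const
  | succ n ih =>
    simp only [zeta]
    refine ih.add (measurable_from_top.comp (measurable_sInf_nat fun t => ?_))
    refine (MeasurableSet.const _).inter (measurableSet_forall fun s => ?_)
    exact (MeasurableSet.const _).imp
      (measurableSet_eval_eq ((ih.sub_const _).add_const _) (ih.sub_const _))

lemma measurable_tildePast : Measurable (tildePast l : Path 𝒳 → ℕ → 𝒳) :=
  measurable_pi_iff.2 fun _ => measurable_eval ((measurable_zeta _).sub_const _)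

lemma measurable_hatDelta (γ : ℝ) (n k : ℕ) :
    Measurable fun ω : Path 𝒳 => hatDelta γ l ω n k := by
  refine measurable_of_factors (h := fun ω : Path 𝒳 =>
    ((fun i : Fin (n + 1) => ω i), zeta l ω (Jfun l k), fun i : Fin k => tildePast l ω i)) ?_ ?_
  · refine (measurable_pi_iff.2 fun i => measurable_pi_apply _).prodMk
      ((measurable_zeta _).prodMk (measurable_pi_iff.2 fun i => ?_))
    exact (measurable_pi_apply _).comp measurable_tildePast
  · intro ω ω' h
    simp only [Prod.mk.injEq, funext_iff] at h
    refine hatDelta_eq_of_agreeUpTo γ (fun i hi hin => ?_) (by rw [h.2.1])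
      fun _ i hi => h.2.2 ⟨i, hi⟩
    lift i to ℕ using hi
    exact h.1 ⟨i, by omega⟩

lemma measurable_chi (β γ : ℝ) (n : ℕ) : Measurable fun ω : Path 𝒳 => chi β γ l ω n :=
  measurable_sInf_nat fun k => (MeasurableSet.const _).inter
    (measurableSet_le (measurable_hatDelta γ n k) measurable_const)

lemma measurable_jIndex (v : ℤ) : Measurable fun ω : Path 𝒳 => jIndex l ω v :=
  measurable_sInf_nat fun _ => measurableSet_lt measurable_const (measurable_zeta _)

lemma measurable_lambda (β γ : ℝ) (n : ℕ) : Measurable fun ω : Path 𝒳 => lambda β γ l ω n := by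
  induction n with
  | zero => exact measurable_const
  | succ n ih =>
    simp only [lambda]
    refine (ih.add_const 1).add (measurable_from_top.comp (measurable_sInf_nat fun s => ?_))
    have h1 : Measurable fun ω : Path 𝒳 =>
        chi β γ l ω (lambda β γ l ω n + 1 + (s : ℤ)).toNat :=
      measurable_apply_countable (g := fun m ω => chi β γ l ω m)
        ((measurable_from_top (f := Int.toNat)).comp ((ih.add_const 1).add_const (s : ℤ)))
        fun m => measurable_chi β γ m
    have h2 : Measurable fun ω : Path 𝒳 => zeta l ω (jIndex l ω (lambda β γ l ω n)) :=
      measurable_apply_countable (g := fun j ω => zeta l ω j)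
        (measurable_apply_countable (g := fun v ω => jIndex l ω v) ih measurable_jIndex)
        measurable_zeta
    refine measurableSet_forall fun r => MeasurableSet.imp ?_
      (measurableSet_eval_eq (((ih.add_const 1).add_const _).sub_const _) (h2.sub_const _))
    exact measurableSet_lt measurable_const h1

lemma measurable_segObs (β γ : ℝ) (n : ℕ) : Measurable (segObs β γ l n : Path 𝒳 → _) :=
  (measurable_lambda β γ n).prodMk (measurable_pi_iff.2 fun _ =>
    measurable_eval (((measurable_lambda β γ n).sub_const _).max measurable_const))

end Measurability

section Shifts

variable {𝒳 : Type*}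

lemma shiftBy_shiftBy (s t : ℤ) (ω : Path 𝒳) : shiftBy s (shiftBy t ω) = shiftBy (s + t) ω := by
  funext i
  simp only [shiftBy, add_assoc]

lemma shiftBy_zero : (shiftBy 0 : Path 𝒳 → Path 𝒳) = id := by
  funext ω i
  simp [shiftBy]

lemma shift_iterate (n : ℕ) : (shift : Path 𝒳 → Path 𝒳)^[n] = shiftBy n := by
  induction n with
  | zero => simp [shiftBy_zero]
  | succ n ih =>
    rw [Function.iterate_succ', ih]
    funext ω i
    simp only [shift, shiftBy, Function.comp]
    congr 1
    push_cast
    ring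

/-- The positive times at which the block of length `L` ending at time `0` recurs. -/
def recurSet (L : ℕ) (ω : Path 𝒳) : Set ℕ :=
  {t : ℕ | 0 < t ∧ ∀ s < L, ω (-(s : ℤ) + (t : ℤ)) = ω (-(s : ℤ))}

lemma zeta_succ (l : ℕ → ℕ) (ω : Path 𝒳) (n : ℕ) :
    zeta l ω (n + 1) =
      zeta l ω n + (sInf (recurSet (l (n + 1)) (shiftBy (zeta l ω n) ω)) : ℕ) := by
  simp only [zeta, recurSet, shiftBy]
  congr 4
  ext t
  refine and_congr_right fun _ => forall₂_congr fun s _ => ?_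
  rw [show -(s : ℤ) + t + zeta l ω n = zeta l ω n - s + t by ring,
    show -(s : ℤ) + zeta l ω n = zeta l ω n - s by ring]

lemma isRecurrent_iff {l : ℕ → ℕ} {ω : Path 𝒳} :
    IsRecurrent l ω ↔ ∀ n, (recurSet (l (n + 1)) (shiftBy (zeta l ω n) ω)).Nonempty := by
  refine forall_congr' fun n => exists_congr fun t => and_congr_right fun _ =>
    forall₂_congr fun s _ => ?_
  rw [shiftBy, shiftBy, show -(s : ℤ) + t + zeta l ω n = zeta l ω n - s + t by ring,
    show -(s : ℤ) + zeta l ω n = zeta l ω n - s by ring]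

end Shifts

section Recurrence

lemma measurePreserving_shiftBy {μ : Measure (Path 𝒳)} (hT : MeasurePreserving shift μ μ) (t : ℤ) :
    MeasurePreserving (shiftBy t) μ μ := by
  have hnat : ∀ n : ℕ, MeasurePreserving (shiftBy n) μ μ := fun n => by
    simpa only [shift_iterate] using hT.iterate n
  rcases Int.eq_nat_or_neg t with ⟨n, rfl | rfl⟩
  · exact hnat n
  · refine ⟨measurable_shiftBy _, ?_⟩
    conv_lhs => rw [← (hnat n).map_eq]
    rw [Measure.map_map (measurable_shiftBy _) (measurable_shiftBy _)]
    have : (shiftBy (-(n : ℤ)) ∘ shiftBy n : Path 𝒳 → Path 𝒳) = id := by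
      funext ω
      simp [shiftBy_shiftBy, shiftBy_zero]
    rw [this, Measure.map_id]

variable [Countable 𝒳] [MeasurableSingletonClass 𝒳]
variable {μ : Measure (Path 𝒳)} [IsProbabilityMeasure μ]

lemma measurableSet_mem_recurSet (L t : ℕ) : MeasurableSet {ω : Path 𝒳 | t ∈ recurSet L ω} :=
  (MeasurableSet.const _).inter (measurableSet_forall fun _ => (MeasurableSet.const _).imp
    (measurableSet_eval_eq measurable_const measurable_const))

lemma ae_recurSet_nonempty (hT : MeasurePreserving shift μ μ) (L : ℕ) :
    ∀ᵐ ω ∂μ, (recurSet L ω).Nonempty := by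
  have key : ∀ w : Fin L → 𝒳, ∀ᵐ ω ∂μ, (∀ i : Fin L, ω (-(i : ℤ)) = w i) →
      (recurSet L ω).Nonempty := by
    intro w
    have hs : MeasurableSet {ω : Path 𝒳 | ∀ i : Fin L, ω (-(i : ℤ)) = w i} :=
      measurableSet_forall fun i => measurableSet_eq_fun (measurable_pi_apply _) measurable_const
    filter_upwards [hT.conservative.ae_mem_imp_frequently_image_mem hs.nullMeasurableSet]
      with ω hω hw
    obtain ⟨n, hn, hmem⟩ := frequently_atTop.1 (hω hw) 1
    refine ⟨n, hn, fun s hs => ?_⟩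
    rw [shift_iterate] at hmem
    exact (hmem ⟨s, hs⟩).trans (hw ⟨s, hs⟩).symm
  filter_upwards [ae_all_iff.2 key] with ω hω
  exact hω (fun i => ω (-(i : ℤ))) fun _ => rfl

/-- The return map to the block of length `L` preserves a stationary measure. -/
lemma measurePreserving_return (hT : MeasurePreserving shift μ μ) (L : ℕ) :
    MeasurePreserving (fun ω : Path 𝒳 => shiftBy (sInf (recurSet L ω) : ℕ) ω) μ μ := by
  have hτ : Measurable fun ω : Path 𝒳 => sInf (recurSet L ω) :=
    measurable_sInf_nat (measurableSet_mem_recurSet L)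
  have hm : Measurable fun ω : Path 𝒳 => shiftBy (sInf (recurSet L ω) : ℕ) ω :=
    measurable_shiftBy_comp ((measurable_from_top (f := Nat.cast)).comp hτ)
  refine ⟨hm, ?_⟩
  have : IsProbabilityMeasure (μ.map fun ω : Path 𝒳 => shiftBy (sInf (recurSet L ω) : ℕ) ω) :=
    Measure.isProbabilityMeasure_map hm.aemeasurable
  refine Measure.eq_of_le_of_measure_univ_eq (Measure.le_iff.2 fun E hE => ?_) (by simp)
  rw [Measure.map_apply hm hE]
  set B : ℕ → Set (Path 𝒳) := fun t => {ω | (0 < t ∧ ∀ s < L, ω (-(s : ℤ) - t) = ω (-(s : ℤ))) ∧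
    ∀ j, 0 < j → j < t → ¬ ∀ s < L, ω (-(s : ℤ) - j) = ω (-(s : ℤ))} with hB
  have hBm : ∀ t, MeasurableSet (B t) := fun t =>
    ((MeasurableSet.const _).inter (measurableSet_forall fun _ => (MeasurableSet.const _).imp
      (measurableSet_eval_eq measurable_const measurable_const))).inter
    (measurableSet_forall fun j => (MeasurableSet.const _).imp ((MeasurableSet.const _).imp
      (measurableSet_forall fun _ => (MeasurableSet.const _).imp
        (measurableSet_eval_eq measurable_const measurable_const)).compl))
  have hdisj : Pairwise (Function.onFun Disjoint fun t => B t ∩ E) := by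
    have hlt : ∀ s t, s < t → Disjoint (B s ∩ E) (B t ∩ E) := by
      intro s t hst
      rw [Set.disjoint_left]
      rintro ω ⟨h1, -⟩ ⟨h2, -⟩
      exact h2.2 s h1.1.1 hst h1.1.2
    intro s t hst
    rcases hst.lt_or_gt with h | h
    · exact hlt s t h
    · exact (hlt t s h).symm
  have hsub : ∀ ω : Path 𝒳, (recurSet L ω).Nonempty →
      shiftBy (sInf (recurSet L ω) : ℕ) ω ∈ B (sInf (recurSet L ω)) := by
    intro ω hne
    obtain ⟨h0, h1⟩ := Nat.sInf_mem hne
    refine ⟨⟨h0, fun s hs => ?_⟩, fun j hj0 hjt hall => ?_⟩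
    · simp only [shiftBy, sub_add_cancel]
      exact (h1 s hs).symm
    · have hlt : sInf (recurSet L ω) - j < sInf (recurSet L ω) := by omega
      refine Nat.notMem_of_lt_sInf hlt ⟨by omega, fun s hs => ?_⟩
      have h2 := hall s hs
      simp only [shiftBy] at h2
      rw [← h1 s hs, ← h2, Nat.cast_sub hjt.le]
      congr 1
      ring
  calc μ ((fun ω : Path 𝒳 => shiftBy (sInf (recurSet L ω) : ℕ) ω) ⁻¹' E)
      ≤ μ (⋃ t : ℕ, shiftBy t ⁻¹' (B t ∩ E)) := by
        refine measure_mono_ae ?_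
        filter_upwards [ae_recurSet_nonempty hT L] with ω hne hω
        exact mem_iUnion.2 ⟨_, hsub ω hne, hω⟩
    _ ≤ ∑' t : ℕ, μ (shiftBy t ⁻¹' (B t ∩ E)) := measure_iUnion_le _
    _ = ∑' t : ℕ, μ (B t ∩ E) := tsum_congr fun t =>
        (measurePreserving_shiftBy hT t).measure_preimage ((hBm t).inter hE).nullMeasurableSet
    _ = μ (⋃ t, B t ∩ E) := (measure_iUnion hdisj fun t => (hBm t).inter hE).symm
    _ ≤ μ E := measure_mono (iUnion_subset fun _ => inter_subset_right)

/-- The shift by the recurrence time `ζ_n` preserves a stationary measure. -/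
lemma measurePreserving_shiftBy_zeta (hT : MeasurePreserving shift μ μ) (l : ℕ → ℕ) (n : ℕ) :
    MeasurePreserving (fun ω : Path 𝒳 => shiftBy (zeta l ω n) ω) μ μ := by
  induction n with
  | zero => simpa only [zeta, shiftBy_zero] using MeasurePreserving.id μ
  | succ n ih =>
    have : (fun ω : Path 𝒳 => shiftBy (zeta l ω (n + 1)) ω) =
        (fun ω : Path 𝒳 => shiftBy (sInf (recurSet (l (n + 1)) ω) : ℕ) ω) ∘
          fun ω : Path 𝒳 => shiftBy (zeta l ω n) ω := by
      funext ω
      simp only [Function.comp, shiftBy_shiftBy, zeta_succ]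
      rw [add_comm]
    rw [this]
    exact (measurePreserving_return hT _).comp ih

lemma ae_isRecurrent (hT : MeasurePreserving shift μ μ) (l : ℕ → ℕ) :
    ∀ᵐ ω ∂μ, IsRecurrent l ω := by
  simp only [isRecurrent_iff]
  exact ae_all_iff.2 fun n => (measurePreserving_shiftBy_zeta hT l n).quasiMeasurePreserving.ae
    (ae_recurSet_nonempty hT _)

/-- The auxiliary process has the distribution of the past of the original one. -/
lemma map_tildePast (hT : MeasurePreserving shift μ μ) {l : ℕ → ℕ} (hl : BlockLengths l) :
    μ.map (tildePast l) = μ.map past := by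
  have h1 : IsProbabilityMeasure (μ.map past) :=
    Measure.isProbabilityMeasure_map measurable_past.aemeasurable
  have hfin : ∀ I : Finset ℕ, IsFiniteMeasure ((μ.map past).map I.restrict) :=
    fun I => inferInstance
  refine IsProjectiveLimit.unique (P := fun I : Finset ℕ => (μ.map past).map I.restrict)
    (fun I => ?_) fun I => rfl
  obtain ⟨j, hj⟩ := (((tendsto_add_atTop_iff_nat 1).2 hl.tendsto).eventually_gt_atTop
    (I.sup id)).exists
  have hI : Measurable (I.restrict (π := fun _ : ℕ => 𝒳)) := Finset.measurable_restrict I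
  have hpres := measurePreserving_shiftBy_zeta hT l j
  change (μ.map (tildePast l)).map I.restrict = (μ.map past).map I.restrict
  rw [Measure.map_map hI measurable_tildePast, Measure.map_map hI measurable_past]
  conv_rhs => rw [← hpres.map_eq]
  rw [Measure.map_map (hI.comp measurable_past) hpres.measurable]
  refine Measure.map_congr ?_
  filter_upwards [ae_isRecurrent hT l] with ω hω
  funext i
  have hi : (i : ℕ) < l (j + 1) := (Finset.le_sup (f := id) i.2).trans_lt hj
  simp only [Function.comp, Finset.restrict, hω.tildePast_eq hl hi, past, shiftBy]
  congr 1
  ring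

end Recurrence

section Frequencies

section Counting

variable {𝒳 : Type*}

lemma occursAt_congr {m : ℕ} {s s' : ℕ → 𝒳} (h : ∀ j < m, s j = s' j) {ω : Path 𝒳}
    {t : ℤ} : OccursAt ω m s t ↔ OccursAt ω m s' t :=
  forall₂_congr fun j hj => by rw [h j hj]

lemma empCond_nonneg (ω : Path 𝒳) (n m : ℕ) (x : 𝒳) (s : ℕ → 𝒳) : 0 ≤ empCond ω n m x s :=
  div_nonneg (Nat.cast_nonneg _) (Nat.cast_nonneg _)

lemma empCond_le_one (ω : Path 𝒳) (n m : ℕ) (x : 𝒳) (s : ℕ → 𝒳) : empCond ω n m x s ≤ 1 := by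
  refine div_le_one_of_le₀ (Nat.cast_le.2 ?_) (Nat.cast_nonneg _)
  refine Finset.card_le_card_of_injOn (fun t => t - 1) (fun t ht => ?_) fun _ _ _ _ h => by
    simpa using h
  simp only [Finset.coe_filter, Finset.mem_Icc, mem_ofPred_eq] at ht ⊢
  refine ⟨by omega, fun j hj => ?_⟩
  have := ht.2 (j + 1) (by omega)
  simp only [withLast, Nat.add_eq_zero_iff, one_ne_zero, and_false, if_false,
    Nat.add_sub_cancel] at this
  rw [← this]
  congr 1
  push_cast
  ring

lemma le_hatDelta {γ : ℝ} {l : ℕ → ℕ} {ω : Path 𝒳} {n k i : ℕ} (hi : 1 ≤ i) (hin : i ≤ n)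
    {z : ℕ → 𝒳} {x : 𝒳} (hz : zeta l ω (Jfun l k) ≤ (half n : ℤ) - 1)
    (hL : inL γ ω n (k + i) (withLast x (prependOld (tildePast l ω) k z))) :
    |empCond ω n k x (tildePast l ω) -
      empCond ω n (k + i) x (prependOld (tildePast l ω) k z)| ≤ hatDelta γ l ω n k := by
  rw [hatDelta, if_pos hz, one_mul]
  refine le_csSup ⟨1, ?_⟩ ⟨i, hi, hin, z, x, hL, rfl⟩
  rintro d ⟨i, -, -, z, x, -, rfl⟩
  have h1 := empCond_nonneg ω n k x (tildePast l ω)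
  have h2 := empCond_le_one ω n k x (tildePast l ω)
  have h3 := empCond_nonneg ω n (k + i) x (prependOld (tildePast l ω) k z)
  have h4 := empCond_le_one ω n (k + i) x (prependOld (tildePast l ω) k z)
  rw [abs_le]
  constructor <;> linarith

/-- The number of occurrences of the string `s` ending at a time in `[0, n)`. -/
def occ (ω : Path 𝒳) (m : ℕ) (s : ℕ → 𝒳) (n : ℕ) : ℕ := cnt ω m s 0 ((n : ℤ) - 1)

lemma occ_add_cnt (ω : Path 𝒳) (m : ℕ) (s : ℕ → 𝒳) {a b : ℕ} (hab : a ≤ b) :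
    occ ω m s a + cnt ω m s a ((b : ℤ) - 1) = occ ω m s b := by
  classical
  simp only [occ, cnt]
  rw [← Finset.card_union_of_disjoint]
  · congr 1
    ext t
    simp only [Finset.mem_union, Finset.mem_filter, Finset.mem_Icc]
    constructor
    · rintro (⟨h, h'⟩ | ⟨h, h'⟩) <;> exact ⟨by omega, h'⟩
    · rintro ⟨h, h'⟩
      rcases lt_or_ge t (a : ℤ) with h2 | h2
      · exact Or.inl ⟨by omega, h'⟩
      · exact Or.inr ⟨by omega, h'⟩
  · rw [Finset.disjoint_left]
    intro t ht ht'
    simp only [Finset.mem_filter, Finset.mem_Icc] at ht ht'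
    omega

lemma occ_succ (ω : Path 𝒳) (m : ℕ) (s : ℕ → 𝒳) (n : ℕ) [Decidable (OccursAt ω m s n)] :
    occ ω m s (n + 1) = occ ω m s n + if OccursAt ω m s n then 1 else 0 := by
  classical
  rw [← occ_add_cnt ω m s n.le_succ]
  congr 1
  simp only [cnt]
  rw [show ((n.succ : ℕ) : ℤ) - 1 = n by push_cast; ring, Finset.Icc_self, Finset.filter_singleton]
  split_ifs <;> simp

end Counting

section Tendsto

lemma tendsto_half_div (a : ℤ) :
    Tendsto (fun n : ℕ => (((half n : ℤ) + a).toNat : ℝ) / n) atTop (𝓝 (1 / 2)) := by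
  have h1 : Tendsto (fun n : ℕ => (1 / 2 : ℝ) + (|(a : ℝ)| + 1) / n) atTop (𝓝 (1 / 2 + 0)) :=
    tendsto_const_nhds.add (tendsto_const_nhds.div_atTop tendsto_natCast_atTop_atTop)
  have h2 : Tendsto (fun n : ℕ => (1 / 2 : ℝ) - (|(a : ℝ)| + 1) / n) atTop (𝓝 (1 / 2 - 0)) :=
    tendsto_const_nhds.sub (tendsto_const_nhds.div_atTop tendsto_natCast_atTop_atTop)
  rw [add_zero] at h1
  rw [sub_zero] at h2
  refine tendsto_of_tendsto_of_tendsto_of_le_of_le' h2 h1 ?_ ?_ <;>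
  · filter_upwards [eventually_ge_atTop (2 * a.natAbs + 1)] with n hn
    have hn0 : (0 : ℝ) < n := by exact_mod_cast (by omega : 0 < n)
    have e1 : (((half n : ℤ) + a).toNat : ℝ) = (half n : ℝ) + a := by
      have h : 0 ≤ (half n : ℤ) + a := by unfold half; omega
      have := Int.toNat_of_nonneg h
      exact_mod_cast this
    have e2 : (n : ℝ) ≤ 2 * half n := by exact_mod_cast (by unfold half; omega : n ≤ 2 * half n)
    have e3 : 2 * (half n : ℝ) ≤ n + 1 := by
      exact_mod_cast (by unfold half; omega : 2 * half n ≤ n + 1)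
    have := neg_abs_le (a : ℝ)
    have := le_abs_self (a : ℝ)
    rw [e1]
    field_simp
    nlinarith

lemma tendsto_add_div (b : ℤ) :
    Tendsto (fun n : ℕ => (((n : ℤ) + b).toNat : ℝ) / n) atTop (𝓝 1) := by
  have h1 : Tendsto (fun n : ℕ => (1 : ℝ) + (b : ℝ) / n) atTop (𝓝 (1 + 0)) :=
    tendsto_const_nhds.add (tendsto_const_nhds.div_atTop tendsto_natCast_atTop_atTop)
  rw [add_zero] at h1
  refine h1.congr' ?_
  filter_upwards [eventually_ge_atTop (b.natAbs + 1)] with n hn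
  have hn0 : (0 : ℝ) < n := by exact_mod_cast (by omega : 0 < n)
  have e1 : (((n : ℤ) + b).toNat : ℝ) = (n : ℝ) + b := by
    have := Int.toNat_of_nonneg (show 0 ≤ (n : ℤ) + b by omega)
    exact_mod_cast this
  rw [e1]
  field_simp

lemma tendsto_comp_div {u : ℕ → ℝ} {p c : ℝ} (hu : Tendsto (fun n : ℕ => u n / n) atTop (𝓝 p))
    {N : ℕ → ℕ} (hN : Tendsto (fun n : ℕ => (N n : ℝ) / n) atTop (𝓝 c)) (hc : 0 < c) :
    Tendsto (fun n : ℕ => u (N n) / n) atTop (𝓝 (p * c)) := by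
  have hNtop : Tendsto N atTop atTop := by
    rw [← tendsto_natCast_atTop_iff (R := ℝ)]
    refine (hN.pos_mul_atTop hc tendsto_natCast_atTop_atTop).congr' ?_
    filter_upwards [eventually_gt_atTop 0] with n hn
    field_simp
  refine ((hu.comp hNtop).mul hN).congr' ?_
  filter_upwards [hNtop.eventually_gt_atTop 0] with n hn
  have : (0 : ℝ) < N n := by exact_mod_cast hn
  simp only [Function.comp]
  field_simp

end Tendsto

variable [Countable 𝒳] [MeasurableSingletonClass 𝒳]
variable {μ : Measure (Path 𝒳)} [IsProbabilityMeasure μ]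

omit [Countable 𝒳] [MeasurableSingletonClass 𝒳] [IsProbabilityMeasure μ] in
lemma pstr_congr {m : ℕ} {s s' : ℕ → 𝒳} (h : ∀ j < m, s j = s' j) : pstr μ m s = pstr μ m s' := by
  simp only [pstr]
  congr 3
  exact funext fun ω => propext (forall₂_congr fun j hj => by rw [h j hj])

omit [IsProbabilityMeasure μ] in
lemma measurableSet_cyl (m : ℕ) (s : ℕ → 𝒳) :
    MeasurableSet {ω : Path 𝒳 | ∀ j < m, ω (-(j : ℤ)) = s j} :=
  measurableSet_forall fun _ => (MeasurableSet.const _).imp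
    (measurableSet_eq_fun (measurable_pi_apply _) measurable_const)

lemma ae_tendsto_occ_div (hErg : Ergodic shift μ) :
    ∀ᵐ ω ∂μ, ∀ m s, Tendsto (fun n : ℕ => (occ ω m s n : ℝ) / n) atTop (𝓝 (pstr μ m s)) := by
  classical
  have key : ∀ m, ∀ w : Fin m → 𝒳, ∀ᵐ ω ∂μ, ∀ s : ℕ → 𝒳, (∀ i : Fin m, s i = w i) →
      Tendsto (fun n : ℕ => (occ ω m s n : ℝ) / n) atTop (𝓝 (pstr μ m s)) := by
    intro m w
    by_cases hw : ∃ s : ℕ → 𝒳, ∀ i : Fin m, s i = w i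
    · obtain ⟨s, hs⟩ := hw
      set E := {ω : Path 𝒳 | ∀ j < m, ω (-(j : ℤ)) = s j} with hE
      have hEm : MeasurableSet E := measurableSet_cyl m s
      filter_upwards [tendsto_birkhoffSum_div hErg (f := E.indicator fun _ => (1 : ℝ))
        (measurable_const.indicator hEm) ((integrable_const _).indicator hEm)] with ω hω s' hs'
      have hss : ∀ j < m, s' j = s j := fun j hj => (hs' ⟨j, hj⟩).trans (hs ⟨j, hj⟩).symm
      rw [pstr_congr hss]
      have hinteg : ∫ ω, E.indicator (fun _ => (1 : ℝ)) ω ∂μ = pstr μ m s := by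
        rw [integral_indicator_const _ hEm]
        simp [pstr, Measure.real, hE]
      rw [hinteg] at hω
      refine hω.congr fun n => ?_
      congr 1
      induction n with
      | zero => simp [occ, cnt]
      | succ n ih =>
        rw [birkhoffSum_succ, ih, occ_succ, shift_iterate]
        have : OccursAt ω m s' n ↔ shiftBy n ω ∈ E := by
          rw [occursAt_congr hss]
          refine forall₂_congr fun j _ => ?_
          rw [shiftBy, show -(j : ℤ) + n = n - j by ring]
        simp only [indicator_apply, ← this]
        split_ifs <;> simp
    · exact Eventually.of_forall fun ω s hs => (hw ⟨s, hs⟩).elim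
  filter_upwards [ae_all_iff.2 fun m => ae_all_iff.2 (key m)] with ω hω m s
  exact hω m (fun i => s i) s fun _ => rfl

omit [Countable 𝒳] [MeasurableSingletonClass 𝒳] [IsProbabilityMeasure μ] in
lemma tendsto_cnt_div {ω : Path 𝒳} {m : ℕ} {s : ℕ → 𝒳}
    (h : Tendsto (fun n : ℕ => (occ ω m s n : ℝ) / n) atTop (𝓝 (pstr μ m s))) (a b : ℤ) :
    Tendsto (fun n : ℕ => (cnt ω m s ((half n : ℤ) + a) ((n : ℤ) + b) : ℝ) / n) atTop
      (𝓝 (pstr μ m s / 2)) := by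
  have h1 := tendsto_comp_div h (tendsto_half_div a) (by norm_num)
  have h2 := tendsto_comp_div h (tendsto_add_div (b + 1)) one_pos
  have h3 := h2.sub h1
  rw [show pstr μ m s * 1 - pstr μ m s * (1 / 2) = pstr μ m s / 2 by ring] at h3
  refine h3.congr' ?_
  filter_upwards [eventually_ge_atTop (2 * a.natAbs + 2 * b.natAbs + 3)] with n hn
  rw [← sub_div]
  congr 1
  have ha : 0 ≤ (half n : ℤ) + a := by unfold half; omega
  have hb : 0 ≤ (n : ℤ) + (b + 1) := by omega
  have hab : ((half n : ℤ) + a).toNat ≤ ((n : ℤ) + (b + 1)).toNat := by unfold half; omega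
  rw [← occ_add_cnt ω m s hab, Int.toNat_of_nonneg ha, Int.toNat_of_nonneg hb]
  push_cast
  rw [add_sub_cancel_left, show (n : ℤ) + (b + 1) - 1 = n + b by ring]

omit [IsProbabilityMeasure μ] in
lemma measure_succ_and_cyl (hT : MeasurePreserving shift μ μ) (m : ℕ) (y : 𝒳) (s : ℕ → 𝒳) :
    μ {ω | ω 1 = y ∧ ∀ j < m, ω (-(j : ℤ)) = s j} =
      μ {ω | ∀ j < m + 1, ω (-(j : ℤ)) = withLast y s j} := by
  rw [← hT.measure_preimage (measurableSet_cyl (m + 1) (withLast y s)).nullMeasurableSet]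
  congr 1
  ext ω
  simp only [mem_ofPred_eq, mem_preimage, shift]
  constructor
  · rintro ⟨h0, h⟩ (_ | j) hj
    · simpa [withLast] using h0
    · have := h j (by omega)
      rw [withLast, if_neg (by omega), Nat.add_sub_cancel, ← this]
      congr 1
      push_cast
      ring
  · intro h
    refine ⟨by simpa [withLast] using h 0 (by omega), fun j hj => ?_⟩
    have := h (j + 1) (by omega)
    rw [withLast, if_neg (by omega), Nat.add_sub_cancel] at this
    rw [← this]
    congr 1
    push_cast
    ring

omit [IsProbabilityMeasure μ] in
lemma pcond_eq (hT : MeasurePreserving shift μ μ) (m : ℕ) (y : 𝒳) (s : ℕ → 𝒳) :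
    pcond μ m y s = pstr μ (m + 1) (withLast y s) / pstr μ m s := by
  rw [pcond, measure_succ_and_cyl hT]
  rfl

lemma pstr_withLast_le (hT : MeasurePreserving shift μ μ) (m : ℕ) (y : 𝒳) (s : ℕ → 𝒳) :
    pstr μ (m + 1) (withLast y s) ≤ pstr μ m s := by
  rw [pstr, ← measure_succ_and_cyl hT]
  exact ENNReal.toReal_mono (measure_ne_top _ _) (measure_mono fun ω h => h.2)

omit [Countable 𝒳] [MeasurableSingletonClass 𝒳] in
lemma pstr_prependOld_le (k i : ℕ) (b z : ℕ → 𝒳) :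
    pstr μ (k + i) (prependOld b k z) ≤ pstr μ k b := by
  refine ENNReal.toReal_mono (measure_ne_top _ _) (measure_mono fun ω h j hj => ?_)
  rw [h j (by omega), prependOld, if_pos hj]

omit [IsProbabilityMeasure μ] in
lemma tendsto_empCond (hT : MeasurePreserving shift μ μ) {ω : Path 𝒳}
    (h : ∀ m s, Tendsto (fun n : ℕ => (occ ω m s n : ℝ) / n) atTop (𝓝 (pstr μ m s)))
    {m : ℕ} (y : 𝒳) {s : ℕ → 𝒳} (hs : 0 < pstr μ m s) :
    Tendsto (fun n => empCond ω n m y s) atTop (𝓝 (pcond μ m y s)) := by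
  have h1 := tendsto_cnt_div (h (m + 1) (withLast y s)) m 0
  have h2 := tendsto_cnt_div (h m s) ((m : ℤ) - 1) (-1)
  have h3 := h1.div h2 (by positivity)
  rw [pcond_eq hT, ← div_div_div_cancel_right₀ (two_ne_zero : (2 : ℝ) ≠ 0)]
  refine h3.congr' ?_
  filter_upwards [eventually_gt_atTop 0] with n hn
  have : (n : ℝ) ≠ 0 := by positivity
  simp only [Pi.div_apply]
  rw [div_div_div_cancel_right₀ this, empCond, add_zero, add_sub_assoc, sub_eq_add_neg (n : ℤ) 1]

omit [Countable 𝒳] [MeasurableSingletonClass 𝒳] [IsProbabilityMeasure μ] in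
lemma eventually_inL {γ : ℝ} (hγ : 0 < γ) {ω : Path 𝒳}
    (h : ∀ m s, Tendsto (fun n : ℕ => (occ ω m s n : ℝ) / n) atTop (𝓝 (pstr μ m s)))
    {m : ℕ} {s : ℕ → 𝒳} (hs : 0 < pstr μ (m + 1) s) : ∀ᶠ n in atTop, inL γ ω n m s := by
  have h1 := tendsto_cnt_div (h (m + 1) s) m 0
  have hev : ∀ᶠ n : ℕ in atTop, inL2 γ ω n m s := by
    have h2 : Tendsto (fun n : ℕ => (n : ℝ) ^ (-γ)) atTop (𝓝 0) :=
      (tendsto_rpow_neg_atTop hγ).comp tendsto_natCast_atTop_atTop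
    filter_upwards [h2.eventually_lt h1 (by positivity), eventually_gt_atTop 0] with n hn hn0
    have hn' : (0 : ℝ) < n := by exact_mod_cast hn0
    rw [lt_div_iff₀ hn', add_zero] at hn
    rwa [inL2, sub_eq_neg_add, Real.rpow_add hn', Real.rpow_one]
  refine Eventually.and ?_ hev
  obtain ⟨n₀, hn₀⟩ := hev.exists
  have hpos : 0 < cnt ω (m + 1) s ((half n₀ : ℤ) + (m : ℤ)) (n₀ : ℤ) := by
    have : (0 : ℝ) ≤ (n₀ : ℝ) ^ (1 - γ) := by positivity
    exact_mod_cast this.trans_lt hn₀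
  obtain ⟨t, ht⟩ := Finset.card_pos.1 hpos
  simp only [Finset.mem_filter, Finset.mem_Icc] at ht
  filter_upwards [eventually_ge_atTop (2 * n₀ + 2)] with n hn
  refine ⟨t, by omega, ?_, ht.2⟩
  unfold half
  omega

/-- A context length which is too short is eventually rejected by the order estimate. -/
lemma ae_eventually_chi_ne (hErg : Ergodic shift μ) (l : ℕ → ℕ) {β γ : ℝ} (hβ : 0 < β)
    (hγ : 0 < γ) :
    ∀ᵐ ω ∂μ, ∀ k, ¬ IsMemoryBound μ (tildePast l ω) k → ∀ᶠ n in atTop, chi β γ l ω n ≠ k := by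
  have hT := hErg.toMeasurePreserving
  filter_upwards [ae_tendsto_occ_div hErg] with ω hω k hk
  simp only [IsMemoryBound, not_forall] at hk
  obtain ⟨i, hi, y, z, hpos, hne⟩ := hk
  set b := tildePast l ω
  have hpos1 : 0 < pstr μ (k + i) (prependOld b k z) := hpos.trans_le (pstr_withLast_le hT _ _ _)
  have hpos2 : 0 < pstr μ k b := hpos1.trans_le (pstr_prependOld_le k i b z)
  have h1 := ((tendsto_empCond hT hω y hpos2).sub (tendsto_empCond hT hω y hpos1)).abs
  have h2 : Tendsto (fun n : ℕ => (n : ℝ) ^ (-β)) atTop (𝓝 0) :=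
    (tendsto_rpow_neg_atTop hβ).comp tendsto_natCast_atTop_atTop
  filter_upwards [h2.eventually_lt h1 (abs_pos.2 (sub_ne_zero.2 hne)), eventually_inL hγ hω hpos,
    eventually_ge_atTop (i + 1), eventually_ge_atTop (2 * (zeta l ω (Jfun l k)).toNat + 2)]
    with n hn hL hin hz hchi
  have hz' : zeta l ω (Jfun l k) ≤ (half n : ℤ) - 1 := by unfold half; omega
  have h3 := le_hatDelta hi (by omega) hz' hL
  have h4 := (chi_mem β γ l ω (show 1 ≤ n by omega)).2
  rw [hchi] at h4
  exact absurd (hn.trans_le (h3.trans h4)) (lt_irrefl _)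

lemma ae_eventually_le_chi (hErg : Ergodic shift μ) (l : ℕ → ℕ) {β γ : ℝ} (hβ : 0 < β)
    (hγ : 0 < γ) :
    ∀ᵐ ω ∂μ, ∀ K, (∀ k < K, ¬ IsMemoryBound μ (tildePast l ω) k) →
      ∀ᶠ n in atTop, K ≤ chi β γ l ω n := by
  filter_upwards [ae_eventually_chi_ne hErg l hβ hγ] with ω hω K hK
  have : ∀ᶠ n in atTop, ∀ k ∈ Finset.range K, chi β γ l ω n ≠ k :=
    (Finset.eventually_all _).2 fun k hk => hω k (hK k (Finset.mem_range.1 hk))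
  filter_upwards [this] with n hn
  by_contra! hlt
  exact hn _ (Finset.mem_range.2 hlt) rfl

end Frequencies

section Predictor

section Strings

variable {𝒳 : Type*}

lemma prependOld_self (b : ℕ → 𝒳) (k : ℕ) : prependOld b k (fun j => b (j + k)) = b := by
  funext j
  unfold prependOld
  split_ifs with h
  · rfl
  · exact congrArg b (Nat.sub_add_cancel (not_lt.1 h))

lemma prependOld_congr {k : ℕ} {b b' : ℕ → 𝒳} (h : ∀ j < k, b j = b' j) (z : ℕ → 𝒳) :
    prependOld b k z = prependOld b' k z := by
  funext j
  unfold prependOld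
  split_ifs with hj
  · exact h j hj
  · rfl

lemma dstar_le_of_agree {x y : ℕ → 𝒳} {m : ℕ} (h : ∀ i < m, x i = y i) :
    dstar x y ≤ (2 : ℝ)⁻¹ ^ m := by
  classical
  have hg : Summable fun i : ℕ => (2 : ℝ)⁻¹ ^ (i + 1) :=
    (summable_nat_add_iff 1).2 (summable_geometric_of_lt_one (by norm_num) (by norm_num))
  have hle : ∀ i : ℕ, (2 : ℝ)⁻¹ ^ (i + 1) * (if x i ≠ y i then (1 : ℝ) else 0) ≤
      (2 : ℝ)⁻¹ ^ (i + 1) := fun i => by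
    have : (0 : ℝ) ≤ (2 : ℝ)⁻¹ ^ (i + 1) := by positivity
    split_ifs <;> simp
  have hnn : ∀ i : ℕ, 0 ≤ (2 : ℝ)⁻¹ ^ (i + 1) * (if x i ≠ y i then (1 : ℝ) else 0) := fun i => by
    split_ifs <;> positivity
  have hs : Summable fun i : ℕ => (2 : ℝ)⁻¹ ^ (i + 1) * (if x i ≠ y i then (1 : ℝ) else 0) :=
    hg.of_nonneg_of_le hnn hle
  have hd : dstar x y = ∑' i : ℕ, (2 : ℝ)⁻¹ ^ (i + 1) * (if x i ≠ y i then (1 : ℝ) else 0) := by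
    unfold dstar
    congr! 5
  rw [hd, ← hs.sum_add_tsum_nat_add m, Finset.sum_eq_zero fun i hi => by
    rw [if_neg (not_not.2 (h i (Finset.mem_range.1 hi))), mul_zero], zero_add]
  calc ∑' i : ℕ, (2 : ℝ)⁻¹ ^ (i + m + 1) * (if x (i + m) ≠ y (i + m) then (1 : ℝ) else 0)
      ≤ ∑' i : ℕ, (2 : ℝ)⁻¹ ^ (i + m + 1) :=
        Summable.tsum_le_tsum (fun i => hle (i + m)) ((summable_nat_add_iff m).2 hs)
          ((summable_nat_add_iff m).2 hg)
    _ = ∑' i : ℕ, (2 : ℝ)⁻¹ ^ (m + 1) * (2 : ℝ)⁻¹ ^ i :=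
        tsum_congr fun i => by rw [← pow_add]; congr 1; omega
    _ = (2 : ℝ)⁻¹ ^ m := by
        rw [tsum_mul_left, tsum_geometric_inv_two, pow_succ]
        ring

end Strings

variable {μ : Measure (Path 𝒳)}

lemma pcond_congr {m : ℕ} {s s' : ℕ → 𝒳} (h : ∀ j < m, s j = s' j) (y : 𝒳) :
    pcond μ m y s = pcond μ m y s' := by
  simp only [pcond, pstr_congr h]
  congr 4
  exact funext fun ω => propext (and_congr_right fun _ => forall₂_congr fun j hj => by rw [h j hj])

lemma IsMemoryBound.congr {b b' : ℕ → 𝒳} {K : ℕ} (hb : IsMemoryBound μ b K)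
    (h : ∀ j < K, b j = b' j) : IsMemoryBound μ b' K := by
  intro i hi y z hpos
  rw [← prependOld_congr h z] at hpos ⊢
  rw [← pcond_congr h]
  exact hb i hi y z hpos

/-- The paths whose past ends with the first `m` symbols of `s`. -/
def cyl (m : ℕ) (s : ℕ → 𝒳) : Set (Path 𝒳) := {ω | ∀ j < m, ω (-(j : ℤ)) = s j}

omit [MeasurableSpace 𝒳] in
lemma cyl_congr {m : ℕ} {s s' : ℕ → 𝒳} (h : ∀ j < m, s j = s' j) : cyl m s = cyl m s' := by
  unfold cyl
  congr 1
  exact funext fun ω => propext (forall₂_congr fun j hj => by rw [h j hj])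

/-- The prediction of `f` at time `1` from the last `m` symbols. -/
def finPred (μ : Measure (Path 𝒳)) (f : 𝒳 → ℝ) (m : ℕ) (s : ℕ → 𝒳) : ℝ :=
  ∫ ω, f (ω 1) ∂(ProbabilityTheory.cond μ (cyl m s))

variable [Countable 𝒳] [MeasurableSingletonClass 𝒳] [IsProbabilityMeasure μ]

lemma map_cond_singleton (m : ℕ) (s : ℕ → 𝒳) (y : 𝒳) :
    ((ProbabilityTheory.cond μ (cyl m s)).map fun ω => ω 1) {y} =
      ENNReal.ofReal (pcond μ m y s) := by
  have hE : MeasurableSet (cyl m s) := measurableSet_cyl m s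
  rw [Measure.map_apply (measurable_pi_apply 1) (measurableSet_singleton y),
    ProbabilityTheory.cond_apply hE, pcond, pstr]
  have : cyl m s ∩ (fun ω : Path 𝒳 => ω 1) ⁻¹' {y} =
      {ω : Path 𝒳 | ω 1 = y ∧ ∀ j < m, ω (-(j : ℤ)) = s j} := by
    ext ω
    exact and_comm
  rw [this, ← ENNReal.toReal_div, ENNReal.ofReal_toReal]
  · rw [ENNReal.div_eq_inv_mul]
    rfl
  · by_cases h0 : μ {ω : Path 𝒳 | ∀ j < m, ω (-(j : ℤ)) = s j} = 0
    · have : μ {ω : Path 𝒳 | ω 1 = y ∧ ∀ j < m, ω (-(j : ℤ)) = s j} = 0 :=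
        measure_mono_null (fun ω h => h.2) h0
      simp [this]
    · exact ENNReal.div_ne_top (measure_ne_top _ _) h0

lemma IsMemoryBound.finPred_eq (hT : MeasurePreserving shift μ μ) (f : 𝒳 → ℝ) {s : ℕ → 𝒳}
    {K m : ℕ} (hK : IsMemoryBound μ s K) (hKm : K ≤ m) (hm : μ (cyl m s) ≠ 0) :
    finPred μ f m s = finPred μ f K s := by
  obtain ⟨i, rfl⟩ := Nat.exists_eq_add_of_le hKm
  rcases Nat.eq_zero_or_pos i with rfl | hi
  · rfl
  have hK0 : μ (cyl K s) ≠ 0 := fun h0 =>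
    hm (measure_mono_null (fun ω (h : ω ∈ cyl (K + i) s) j hj => h j (Nat.lt_add_right i hj)) h0)
  have hm1 : Measurable fun ω : Path 𝒳 => ω 1 := measurable_pi_apply 1
  have p1 := ProbabilityTheory.cond_isProbabilityMeasure hm
  have p2 := ProbabilityTheory.cond_isProbabilityMeasure hK0
  have q1 := Measure.isProbabilityMeasure_map (μ := ProbabilityTheory.cond μ (cyl (K + i) s))
    hm1.aemeasurable
  have q2 := Measure.isProbabilityMeasure_map (μ := ProbabilityTheory.cond μ (cyl K s))
    hm1.aemeasurable
  have hle : (ProbabilityTheory.cond μ (cyl (K + i) s)).map (fun ω => ω 1) ≤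
      (ProbabilityTheory.cond μ (cyl K s)).map (fun ω => ω 1) := by
    refine Measure.le_iff.2 fun E hE => ?_
    rw [← Measure.tsum_indicator_apply_singleton _ _ hE,
      ← Measure.tsum_indicator_apply_singleton _ _ hE]
    refine ENNReal.tsum_le_tsum fun y => indicator_le_indicator ?_
    rw [map_cond_singleton, map_cond_singleton]
    refine ENNReal.ofReal_le_ofReal ?_
    have hnn : 0 ≤ pstr μ (K + i + 1) (withLast y s) := ENNReal.toReal_nonneg
    rcases hnn.eq_or_lt with h0 | hpos
    · rw [pcond_eq hT (K + i), ← h0, zero_div]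
      exact div_nonneg ENNReal.toReal_nonneg ENNReal.toReal_nonneg
    · have h := hK i hi y (fun j => s (j + K))
      rw [prependOld_self] at h
      exact (h hpos).ge
  have heq := Measure.eq_of_le_of_measure_univ_eq hle (by simp)
  have hf : Measurable f := measurable_of_countable f
  rw [finPred, finPred, ← integral_map hm1.aemeasurable hf.aestronglyMeasurable, heq,
    integral_map hm1.aemeasurable hf.aestronglyMeasurable]

/-- The last `m` symbols. -/
def pastFin (m : ℕ) (ω : Path 𝒳) : Fin m → 𝒳 := fun i => ω (-(i : ℤ))

omit [Countable 𝒳] [MeasurableSingletonClass 𝒳] in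
lemma measurable_pastFin (m : ℕ) : Measurable (pastFin m : Path 𝒳 → _) :=
  measurable_pi_iff.2 fun _ => measurable_pi_apply _

/-- The filtration generated by longer and longer finite pasts. -/
def pastFiltration (𝒳 : Type*) [MeasurableSpace 𝒳] :
    Filtration ℕ (inferInstance : MeasurableSpace (Path 𝒳)) where
  seq m := MeasurableSpace.comap (pastFin m) inferInstance
  mono' m n hmn := by
    have hp : Measurable fun (w : Fin n → 𝒳) (i : Fin m) => w (Fin.castLE hmn i) :=
      measurable_pi_iff.2 fun _ => measurable_pi_apply _
    have : (pastFin m : Path 𝒳 → _) =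
      (fun (w : Fin n → 𝒳) (i : Fin m) => w (Fin.castLE hmn i)) ∘ pastFin n := rfl
    simp only [this, ← MeasurableSpace.comap_comp]
    exact MeasurableSpace.comap_mono hp.comap_le
  le' m := (measurable_pastFin m).comap_le

omit [Countable 𝒳] [MeasurableSingletonClass 𝒳] in
lemma iSup_pastFiltration : ⨆ m, pastFiltration 𝒳 m = pastSigma 𝒳 := by
  refine le_antisymm (iSup_le fun m => ?_) ?_
  · have hp : Measurable fun (w : ℕ → 𝒳) (i : Fin m) => w i :=
      measurable_pi_iff.2 fun _ => measurable_pi_apply _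
    have : (pastFin m : Path 𝒳 → _) = (fun (w : ℕ → 𝒳) (i : Fin m) => w i) ∘ past := rfl
    change MeasurableSpace.comap (pastFin m) inferInstance ≤ _
    rw [this, ← MeasurableSpace.comap_comp]
    exact MeasurableSpace.comap_mono hp.comap_le
  · refine (@measurable_iff_comap_le _ _ (⨆ m, pastFiltration 𝒳 m) _ past).1
      (@measurable_pi_lambda _ _ _ (⨆ m, pastFiltration 𝒳 m) _ _ fun i => ?_)
    have h1 : Measurable[MeasurableSpace.comap (pastFin (i + 1)) inferInstance]
        (pastFin (i + 1) : Path 𝒳 → _) := comap_measurable _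
    have h2 := (measurable_pi_apply (Fin.last i)).comp h1
    exact h2.mono (le_iSup (fun m => pastFiltration 𝒳 m) (i + 1)) le_rfl

omit [MeasurableSingletonClass 𝒳] [IsProbabilityMeasure μ] in
lemma ae_measure_cyl_ne_zero : ∀ᵐ ω ∂μ, ∀ m, μ (cyl m (past ω)) ≠ 0 := by
  refine ae_all_iff.2 fun m => ?_
  have key : ∀ w : Fin m → 𝒳, ∀ᵐ ω ∂μ, pastFin m ω = w → μ (cyl m (past ω)) ≠ 0 := by
    intro w
    by_cases h : μ (pastFin m ⁻¹' {w}) = 0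
    · filter_upwards [measure_eq_zero_iff_ae_notMem.1 h] with ω hω hw
      exact (hω hw).elim
    · refine Eventually.of_forall fun ω hω h0 => h (measure_mono_null ?_ h0)
      rintro ω' hω' j hj
      exact congrFun (hω'.trans hω.symm) ⟨j, hj⟩
  filter_upwards [ae_all_iff.2 key] with ω hω
  exact hω _ rfl

lemma integrable_apply_one {f : 𝒳 → ℝ} {M : ℝ} (hf : ∀ x, |f x| ≤ M) :
    Integrable (fun ω : Path 𝒳 => f (ω 1)) μ :=
  Integrable.of_bound (((measurable_of_countable f).comp (measurable_pi_apply 1)).aestronglyMeasurable)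
    M (Eventually.of_forall fun ω => hf (ω 1))

lemma condExp_pastFiltration {f : 𝒳 → ℝ} {M : ℝ} (hf : ∀ x, |f x| ≤ M) (m : ℕ) :
    ∀ᵐ ω ∂μ, (μ[fun ω => f (ω 1)|pastFiltration 𝒳 m]) ω = finPred μ f m (past ω) := by
  have hsm : StronglyMeasurable[pastFiltration 𝒳 m]
      (μ[fun ω : Path 𝒳 => f (ω 1)|pastFiltration 𝒳 m]) := stronglyMeasurable_condExp
  obtain ⟨h, -, hh⟩ := Measurable.exists_eq_measurable_comp
    (show Measurable[MeasurableSpace.comap (pastFin m) inferInstance] _ from hsm.measurable)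
  filter_upwards [ae_measure_cyl_ne_zero (μ := μ)] with ω hω
  have hE : cyl m (past ω) = pastFin m ⁻¹' {pastFin m ω} := by
    ext ω'
    simp only [mem_preimage, mem_singleton_iff, funext_iff]
    exact ⟨fun h i => h i i.2, fun h j hj => h ⟨j, hj⟩⟩
  have hEm : MeasurableSet[pastFiltration 𝒳 m] (cyl m (past ω)) :=
    ⟨{pastFin m ω}, measurableSet_singleton _, hE.symm⟩
  have hEm' : MeasurableSet (cyl m (past ω)) := (pastFiltration 𝒳).le m _ hEm
  have h1 := setIntegral_condExp ((pastFiltration 𝒳).le m) (integrable_apply_one (μ := μ) hf) hEm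
  have h2 : ∫ ω' in cyl m (past ω), (μ[fun ω : Path 𝒳 => f (ω 1)|pastFiltration 𝒳 m]) ω' ∂μ =
      ∫ _ in cyl m (past ω), h (pastFin m ω) ∂μ := by
    refine setIntegral_congr_fun hEm' fun ω' hω' => ?_
    rw [hE] at hω'
    simp only [hh, Function.comp]
    exact congrArg h hω'
  rw [h2, setIntegral_const] at h1
  have hpos : μ.real (cyl m (past ω)) ≠ 0 :=
    (ENNReal.toReal_pos (hω m) (measure_ne_top _ _)).ne'
  rw [finPred, ProbabilityTheory.cond, integral_smul_measure, ← h1, hh]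
  simp only [Function.comp, smul_eq_mul, ENNReal.toReal_inv]
  exact (inv_mul_cancel_left₀ hpos _).symm

/-- The predictions from longer and longer finite pasts converge to the predictor. -/
lemma ae_tendsto_finPred {f : 𝒳 → ℝ} {M : ℝ} (hf : ∀ x, |f x| ≤ M) :
    ∀ᵐ ω ∂μ, Tendsto (fun m => finPred μ f m (past ω)) atTop
      (𝓝 ((μ[fun ω => f (ω 1)|pastSigma 𝒳]) ω)) := by
  have h := tendsto_ae_condExp (μ := μ) (ℱ := pastFiltration 𝒳) fun ω : Path 𝒳 => f (ω 1)
  rw [iSup_pastFiltration] at h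
  filter_upwards [h, ae_all_iff.2 fun m => condExp_pastFiltration (μ := μ) hf m] with ω h1 h2
  exact h1.congr h2

omit [Countable 𝒳] [MeasurableSingletonClass 𝒳] in
/-- A bounded measurable version of a predictor. -/
lemma IsPredictor.exists_bounded {f : 𝒳 → ℝ} {M : ℝ} (hf : ∀ x, |f x| ≤ M)
    {F : (ℕ → 𝒳) → ℝ} (hF : IsPredictor μ f F) :
    ∃ F' : (ℕ → 𝒳) → ℝ, Measurable F' ∧ (∀ x, |F' x| ≤ M) ∧ IsPredictor μ f F' ∧
      ∀ᵐ ω ∂μ, F (past ω) = F' (past ω) := by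
  have hM : 0 ≤ M := by
    obtain ⟨ω⟩ := nonempty_of_isProbabilityMeasure μ
    exact (abs_nonneg _).trans (hf (ω 0))
  have hsm : StronglyMeasurable[pastSigma 𝒳]
      (μ[fun ω : Path 𝒳 => f (ω 1)|pastSigma 𝒳]) := stronglyMeasurable_condExp
  obtain ⟨h, hm, hh⟩ := Measurable.exists_eq_measurable_comp
    (show Measurable[MeasurableSpace.comap past inferInstance] _ from hsm.measurable)
  have hbd : ∀ᵐ ω ∂μ, |(μ[fun ω : Path 𝒳 => f (ω 1)|pastSigma 𝒳]) ω| ≤ M :=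
    ae_bdd_abs_condExp_of_ae_bdd_abs (Eventually.of_forall fun ω => hf (ω 1))
  have hpred : IsPredictor μ f fun x => max (-M) (min M (h x)) := by
    filter_upwards [hbd] with ω hω
    rw [hh] at hω ⊢
    simp only [Function.comp] at hω ⊢
    rw [min_eq_right (abs_le.1 hω).2, max_eq_right (abs_le.1 hω).1]
  refine ⟨fun x => max (-M) (min M (h x)), measurable_const.max (measurable_const.min hm),
    fun x => ?_, hpred, ?_⟩
  · rw [abs_le]
    exact ⟨le_max_left _ _, max_le (by linarith) (min_le_left _ _)⟩
  · filter_upwards [hF, hpred] with ω h1 h2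
    exact h1.trans h2.symm

/-- Regularity of a predictor on a set of full measure: `F` coincides with `F'`, which is
continuous on this set, and depends only on the symbols within the memory bound. -/
structure RegularOn (μ : Measure (Path 𝒳)) (F F' : (ℕ → 𝒳) → ℝ) (G : Set (ℕ → 𝒳)) : Prop where
  eq : ∀ x ∈ G, F x = F' x
  cont : ∀ x ∈ G, ∀ ε > 0, ∃ m : ℕ, ∀ y ∈ G, (∀ i < m, x i = y i) → |F' y - F' x| ≤ ε
  memory : ∀ x ∈ G, ∀ y ∈ G, ∀ K, IsMemoryBound μ x K → (∀ i < K, x i = y i) → F' x = F' y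

/-- On small cylinders meeting a continuity set, a predictor is essentially almost constant. -/
lemma ContinuousOnDstar.exists_ae_close {F F' : (ℕ → 𝒳) → ℝ} {C : Set (ℕ → 𝒳)}
    (hFm : Measurable F') (hFF : ∀ᵐ ω ∂μ, F (past ω) = F' (past ω)) (hC1 : μ (past ⁻¹' C) = 1)
    (hC : ContinuousOnDstar F C) {x : ℕ → 𝒳} (hx : x ∈ C) {ε : ℝ} (hε : 0 < ε) :
    ∃ m : ℕ, ∃ c : ℝ, ∀ᵐ ω ∂μ, (∀ i < m, past ω i = x i) → |F' (past ω) - c| ≤ ε := by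
  obtain ⟨δ, hδ, h⟩ := hC x hx ε hε
  obtain ⟨m, hm⟩ := exists_pow_lt_of_lt_one hδ (show (2 : ℝ)⁻¹ < 1 by norm_num)
  refine ⟨m, F x, ?_⟩
  set A : Set (Path 𝒳) := {ω | (∀ i < m, past ω i = x i) → |F' (past ω) - F x| ≤ ε} with hA
  have hAm : MeasurableSet A := by
    refine MeasurableSet.imp (measurableSet_cyl m x) (measurableSet_le ?_ measurable_const)
    exact ((hFm.comp measurable_past).sub_const _).abs
  have hsub : past ⁻¹' C ≤ᵐ[μ] A := by
    filter_upwards [hFF] with ω hω hωC hag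
    rw [← hω]
    exact (h _ hωC ((dstar_le_of_agree fun i hi => (hag i hi).symm).trans_lt hm)).le
  have h1 : μ A = 1 := le_antisymm prob_le_one (hC1 ▸ measure_mono_ae hsub)
  exact (mem_ae_iff_prob_eq_one hAm).2 h1

omit [Countable 𝒳] [MeasurableSingletonClass 𝒳] in
lemma ae_of_subset_of_measure_eq_one {A S : Set (Path 𝒳)} (hA : MeasurableSet A) (hS : μ S = 1)
    (h : S ⊆ A) : ∀ᵐ ω ∂μ, ω ∈ A :=
  (mem_ae_iff_prob_eq_one hA).2 (le_antisymm prob_le_one (hS ▸ measure_mono h))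

lemma ASContinuousCondExp.exists_regularOn (hT : MeasurePreserving shift μ μ) {f : 𝒳 → ℝ} {M : ℝ}
    (hf : ∀ x, |f x| ≤ M) {F F' : (ℕ → 𝒳) → ℝ} (hc : ASContinuousCondExp μ F) (hFm : Measurable F')
    (hF : IsPredictor μ f F') (hFF : ∀ᵐ ω ∂μ, F (past ω) = F' (past ω)) :
    ∃ G : Set (ℕ → 𝒳), (∀ᵐ ω ∂μ, past ω ∈ G) ∧ RegularOn μ F F' G := by
  obtain ⟨C, hC1, hC⟩ := hc
  set Q : (q m : ℕ) → (Fin m → 𝒳) → ℝ → Prop := fun q m w c =>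
    ∀ᵐ ω ∂μ, pastFin m ω = w → |F' (past ω) - c| ≤ 1 / ((q : ℝ) + 1) with hQ
  have hcover : ∀ q : ℕ, ∀ᵐ ω ∂μ, ∃ m, ∃ c, Q q m (pastFin m ω) c := by
    intro q
    refine ae_of_subset_of_measure_eq_one (S := past ⁻¹' C)
      (A := {ω | ∃ m, ∃ c, Q q m (pastFin m ω) c}) ?_ hC1 fun ω hω => ?_
    · have : {ω : Path 𝒳 | ∃ m, ∃ c, Q q m (pastFin m ω) c} =
          ⋃ m, pastFin m ⁻¹' {w | ∃ c, Q q m w c} := by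
        ext ω
        simp
      rw [this]
      exact MeasurableSet.iUnion fun m => measurable_pastFin m (to_countable _).measurableSet
    · obtain ⟨m, c, h⟩ := hC.exists_ae_close hFm hFF hC1 hω (ε := 1 / ((q : ℝ) + 1)) (by positivity)
      refine ⟨m, c, ?_⟩
      filter_upwards [h] with ω' h' hw
      exact h' fun i hi => congrFun hw ⟨i, hi⟩
  have hclose : ∀ᵐ ω ∂μ, ∀ q m : ℕ, ∀ w : Fin m → 𝒳, ∀ hw : ∃ c, Q q m w c,
      pastFin m ω = w → |F' (past ω) - hw.choose| ≤ 1 / ((q : ℝ) + 1) :=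
    ae_all_iff.2 fun q => ae_all_iff.2 fun m => ae_all_iff.2 fun w => ae_all_iff.2 fun hw =>
      hw.choose_spec
  have hpf : ∀ (m : ℕ) (ω : Path 𝒳), pastFin m ω = fun i : Fin m => past ω i := fun _ _ => rfl
  simp only [hpf] at hcover hclose
  refine ⟨{x | F x = F' x ∧ (∀ q : ℕ, ∃ m, ∃ c, Q q m (fun i => x i) c) ∧
    (∀ q m : ℕ, ∀ w : Fin m → 𝒳, ∀ hw : ∃ c, Q q m w c,
      (fun i : Fin m => x i) = w → |F' x - hw.choose| ≤ 1 / ((q : ℝ) + 1)) ∧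
    (∀ m, μ (cyl m x) ≠ 0) ∧ Tendsto (fun m => finPred μ f m x) atTop (𝓝 (F' x))}, ?_, ?_⟩
  · filter_upwards [hFF, ae_all_iff.2 hcover, hclose, ae_measure_cyl_ne_zero (μ := μ),
      ae_tendsto_finPred (μ := μ) hf, hF] with ω h1 h2 h3 h4 h5 h6
    refine ⟨h1, h2, h3, h4, ?_⟩
    rwa [← h6] at h5
  · refine ⟨fun x hx => hx.1, fun x hx ε hε => ?_, fun x hx y hy K hK hxy => ?_⟩
    · obtain ⟨q, hq⟩ := exists_nat_one_div_lt (half_pos hε)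
      obtain ⟨m, hm⟩ := hx.2.1 q
      refine ⟨m, fun y hy hxy => ?_⟩
      have e1 := hx.2.2.1 q m _ hm rfl
      have e2 := hy.2.2.1 q m _ hm (funext fun i => (hxy i i.2).symm)
      rw [abs_le] at e1 e2 ⊢
      constructor <;> linarith [e1.1, e1.2, e2.1, e2.2]
    · have hval : ∀ z, (∀ m, μ (cyl m z) ≠ 0) →
          Tendsto (fun m => finPred μ f m z) atTop (𝓝 (F' z)) → IsMemoryBound μ z K →
          F' z = finPred μ f K z := fun z h0 ht hb =>
        tendsto_nhds_unique ht (tendsto_const_nhds.congr' (by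
          filter_upwards [eventually_ge_atTop K] with m hm
          exact (hb.finPred_eq hT f hm (h0 m)).symm))
      rw [hval x hx.2.2.2.1 hx.2.2.2.2 hK, hval y hy.2.2.2.1 hy.2.2.2.2 (hK.congr hxy), finPred,
        finPred, cyl_congr hxy]

end Predictor

section ConvergenceAlongLambda

variable {μ : Measure (Path 𝒳)} {l : ℕ → ℕ} {β γ : ℝ}

lemma RegularOn.tendsto_lambda {F F' : (ℕ → 𝒳) → ℝ} {G : Set (ℕ → 𝒳)} (hG : RegularOn μ F F' G)
    (hl : BlockLengths l) {ω : Path 𝒳} (hω : IsRecurrent l ω) (h0 : tildePast l ω ∈ G)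
    (h1 : ∀ t, past (shiftBy t ω) ∈ G)
    (hchi : ∀ K, (∀ k < K, ¬ IsMemoryBound μ (tildePast l ω) k) →
      ∀ᶠ n in atTop, K ≤ chi β γ l ω n) :
    Tendsto (fun n => F' (past (shiftBy (lambda β γ l ω n) ω))) atTop
      (𝓝 (F' (tildePast l ω))) := by
  have hlam : Tendsto (fun n => (lambda β γ l ω n).toNat) atTop atTop :=
    tendsto_atTop_mono (fun n => by have := le_lambda β γ l ω n; rw [id]; omega) tendsto_id
  have hagree : ∀ K, (∀ k < K, ¬ IsMemoryBound μ (tildePast l ω) k) →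
      ∀ᶠ n in atTop, ∀ i < K, tildePast l ω i = past (shiftBy (lambda β γ l ω n) ω) i := by
    intro K hK
    rw [← map_add_atTop_eq_nat 1, eventually_map]
    filter_upwards [((tendsto_add_atTop_iff_nat 1).2 hlam).eventually (hchi K hK)] with n hn i hi
    rw [← hω.apply_lambda_sub hl β γ n (hi.trans_le hn), past, shiftBy]
    congr 1
    ring
  by_cases hK : ∃ K, IsMemoryBound μ (tildePast l ω) K
  · classical
    refine tendsto_const_nhds.congr' ?_
    filter_upwards [hagree (Nat.find hK) fun k hk => Nat.find_min hK hk] with n hn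
    exact hG.memory _ h0 _ (h1 _) _ (Nat.find_spec hK) hn
  · rw [not_exists] at hK
    refine Metric.tendsto_atTop'.2 fun ε hε => ?_
    obtain ⟨m, hm⟩ := hG.cont _ h0 (ε / 2) (half_pos hε)
    obtain ⟨N, hN⟩ := eventually_atTop.1 (hagree m fun k _ => hK k)
    refine ⟨N, fun n hn => ?_⟩
    rw [Real.dist_eq]
    exact (hm _ (h1 _) (hN n hn.le)).trans_lt (half_lt_self hε)

end ConvergenceAlongLambda

section Residuals

lemma integral_eq_zero_of_fibers {Ω ι : Type*} {m0 : MeasurableSpace Ω} {μ : Measure Ω}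
    [Countable ι] [MeasurableSpace ι] [MeasurableSingletonClass ι] {τ : Ω → ι} (hτ : Measurable τ)
    {g : Ω → ℝ} (hg : Integrable g μ) (h : ∀ i, ∫ ω in τ ⁻¹' {i}, g ω ∂μ = 0) :
    ∫ ω, g ω ∂μ = 0 := by
  have hU : ⋃ i, τ ⁻¹' {i} = univ := by
    ext ω
    simp
  rw [← setIntegral_univ, ← hU, integral_iUnion (fun i => hτ (measurableSet_singleton i))
    (pairwise_disjoint_fiber τ) hg.integrableOn]
  simp [h]

/-- The symbols at the times `0, …, t`. -/
def initial (t : ℕ) (ω : Path 𝒳) : Fin (t + 1) → 𝒳 := fun i => ω i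

lemma initial_eq_iff {𝒳 : Type*} {t : ℕ} {ω ω' : Path 𝒳} :
    initial t ω = initial t ω' ↔ AgreeUpTo t ω ω' := by
  simp only [initial, funext_iff]
  refine ⟨fun h i hi hit => ?_, fun h i => h i (by omega) (by omega)⟩
  lift i to ℕ using hi
  exact h ⟨i, by omega⟩

lemma measurable_initial (t : ℕ) : Measurable (initial t : Path 𝒳 → _) :=
  measurable_pi_iff.2 fun _ => measurable_pi_apply _

variable [Countable 𝒳] [MeasurableSingletonClass 𝒳]
variable {μ : Measure (Path 𝒳)} [IsProbabilityMeasure μ] {l : ℕ → ℕ} {β γ : ℝ}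

/-- An event which is decided at time `t` on recurrent paths. -/
def DecidedAt (l : ℕ → ℕ) (t : ℕ) (E : Set (Path 𝒳)) : Prop :=
  ∀ ω ω', IsRecurrent l ω → IsRecurrent l ω' → AgreeUpTo t ω ω' → ω ∈ E → ω' ∈ E

lemma DecidedAt.ae_eq_preimage (hT : MeasurePreserving shift μ μ) {t : ℕ} {E : Set (Path 𝒳)}
    (hE : DecidedAt l t E) : ∃ S : Set (Fin (t + 1) → 𝒳), E =ᵐ[μ] initial t ⁻¹' S := by
  refine ⟨initial t '' (E ∩ {ω | IsRecurrent l ω}), ?_⟩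
  filter_upwards [ae_isRecurrent hT l] with ω hω
  refine propext ⟨fun h => ⟨ω, ⟨h, hω⟩, rfl⟩, ?_⟩
  rintro ⟨ω', ⟨h', hω'⟩, he⟩
  exact hE ω' ω hω' hω (initial_eq_iff.1 he) h'

variable {f : 𝒳 → ℝ} {M : ℝ} {F : (ℕ → 𝒳) → ℝ}

/-- The prediction error at time `0`. -/
def residual (f : 𝒳 → ℝ) (F : (ℕ → 𝒳) → ℝ) (ω : Path 𝒳) : ℝ := f (ω 1) - F (past ω)

omit [IsProbabilityMeasure μ] in
lemma measurable_residual (hFm : Measurable F) : Measurable (residual f F) :=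
  ((measurable_of_countable f).comp (measurable_pi_apply 1)).sub (hFm.comp measurable_past)

lemma abs_residual_le {𝒳 : Type*} {f : 𝒳 → ℝ} {F : (ℕ → 𝒳) → ℝ} (hf : ∀ x, |f x| ≤ M)
    (hFb : ∀ x, |F x| ≤ M) (ω : Path 𝒳) :
    |residual f F ω| ≤ 2 * M := by
  have h1 := abs_le.1 (hf (ω 1))
  have h2 := abs_le.1 (hFb (past ω))
  rw [residual, abs_le]
  constructor <;> linarith [h1.1, h1.2, h2.1, h2.2]

lemma integral_mul_residual (hf : ∀ x, |f x| ≤ M) (hF : IsPredictor μ f F)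
    {g : (ℕ → 𝒳) → ℝ} (hg : Measurable g) {C : ℝ} (hgb : ∀ x, |g x| ≤ C) :
    ∫ ω, g (past ω) * residual f F ω ∂μ = 0 := by
  have hi : Integrable (fun ω : Path 𝒳 => f (ω 1)) μ := integrable_apply_one hf
  have hle : pastSigma 𝒳 ≤ (inferInstance : MeasurableSpace (Path 𝒳)) := measurable_past.comap_le
  have hgm : StronglyMeasurable[pastSigma 𝒳] fun ω : Path 𝒳 => g (past ω) :=
    (hg.comp (comap_measurable past)).stronglyMeasurable
  have hgm' : AEStronglyMeasurable (fun ω : Path 𝒳 => g (past ω)) μ :=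
    (hg.comp measurable_past).aestronglyMeasurable
  have hgb' : ∀ᵐ ω ∂μ, ‖g (past ω)‖ ≤ C := Eventually.of_forall fun ω => hgb _
  have hgi : Integrable (fun ω : Path 𝒳 => g (past ω) * f (ω 1)) μ := hi.bdd_mul hgm' hgb'
  have hgc : Integrable (fun ω : Path 𝒳 => g (past ω) *
      (μ[fun ω => f (ω 1)|pastSigma 𝒳]) ω) μ := integrable_condExp.bdd_mul hgm' hgb'
  have h1 : μ[(fun ω : Path 𝒳 => g (past ω)) * (fun ω => f (ω 1))|pastSigma 𝒳] =ᵐ[μ]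
      (fun ω : Path 𝒳 => g (past ω)) * μ[fun ω => f (ω 1)|pastSigma 𝒳] :=
    condExp_mul_of_stronglyMeasurable_left hgm hgi hi
  have h2 : ∫ ω, g (past ω) * residual f F ω ∂μ =
      ∫ ω, (g (past ω) * f (ω 1) - g (past ω) * (μ[fun ω => f (ω 1)|pastSigma 𝒳]) ω) ∂μ := by
    refine integral_congr_ae ?_
    filter_upwards [hF] with ω hω
    rw [residual, ← hω, mul_sub]
  rw [h2, integral_sub hgi hgc, sub_eq_zero, ← integral_condExp hle]
  exact integral_congr_ae h1

lemma setIntegral_residual_eq_zero (hT : MeasurePreserving shift μ μ) (hf : ∀ x, |f x| ≤ M)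
    (hF : IsPredictor μ f F) (hFm : Measurable F) {g : (ℕ → 𝒳) → ℝ} (hg : Measurable g) {C : ℝ}
    (hgb : ∀ x, |g x| ≤ C) {t : ℕ} {E : Set (Path 𝒳)} (hE : DecidedAt l t E) :
    ∫ ω in E, g (past (shiftBy t ω)) * residual f F (shiftBy t ω) ∂μ = 0 := by
  classical
  obtain ⟨S, hS⟩ := hE.ae_eq_preimage hT
  have hSm : MeasurableSet S := (to_countable S).measurableSet
  set r : (ℕ → 𝒳) → Fin (t + 1) → 𝒳 := fun x i => x (t - i) with hr
  have hrm : Measurable r := measurable_pi_iff.2 fun _ => measurable_pi_apply _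
  have hri : ∀ ω : Path 𝒳, r (past (shiftBy t ω)) = initial t ω := fun ω => by
    funext i
    simp only [hr, past, shiftBy, initial]
    congr 1
    have := i.2
    omega
  rw [setIntegral_congr_set hS, ← integral_indicator (measurable_initial t hSm)]
  have h1 : Measurable ((r ⁻¹' S).indicator g) := hg.indicator (hrm hSm)
  have h2 : ∀ x, |(r ⁻¹' S).indicator g x| ≤ C := fun x => by
    rw [indicator_apply]
    split_ifs
    · exact hgb x
    · rw [abs_zero]
      exact (abs_nonneg _).trans (hgb x)
  have h3 := integral_mul_residual hf hF h1 h2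
  have hp := measurePreserving_shiftBy hT (t : ℤ)
  have h4 : Measurable fun ω : Path 𝒳 => (r ⁻¹' S).indicator g (past ω) * residual f F ω :=
    (h1.comp measurable_past).mul (measurable_residual hFm)
  rw [← hp.map_eq, integral_map hp.measurable.aemeasurable h4.aestronglyMeasurable] at h3
  rw [← h3]
  congr 1
  funext ω
  simp only [indicator_apply, mem_preimage, hri]
  split_ifs <;> simp

omit [IsProbabilityMeasure μ] in
lemma measurable_residual_lambda (hFm : Measurable F) (n : ℕ) :
    Measurable fun ω : Path 𝒳 => residual f F (shiftBy (lambda β γ l ω n) ω) :=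
  (measurable_residual hFm).comp (measurable_shiftBy_comp (measurable_lambda β γ n))

/-- The prediction errors along the stopping times are orthogonal. -/
lemma integral_residual_mul_residual (hT : MeasurePreserving shift μ μ) (hl : BlockLengths l)
    (hf : ∀ x, |f x| ≤ M) (hF : IsPredictor μ f F) (hFm : Measurable F) (hFb : ∀ x, |F x| ≤ M)
    {i j : ℕ} (hij : i < j) :
    ∫ ω, residual f F (shiftBy (lambda β γ l ω i) ω) *
      residual f F (shiftBy (lambda β γ l ω j) ω) ∂μ = 0 := by
  have hmi := measurable_residual_lambda (f := f) (β := β) (γ := γ) (l := l) hFm i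
  have hmj := measurable_residual_lambda (f := f) (β := β) (γ := γ) (l := l) hFm j
  refine integral_eq_zero_of_fibers (τ := fun ω : Path 𝒳 => (lambda β γ l ω i, lambda β γ l ω j))
    ((measurable_lambda β γ i).prodMk (measurable_lambda β γ j)) ?_ ?_
  · refine Integrable.of_bound (hmi.mul hmj).aestronglyMeasurable (2 * M * (2 * M))
      (Eventually.of_forall fun ω => ?_)
    rw [norm_mul]
    have h1 := abs_residual_le hf hFb (shiftBy (lambda β γ l ω i) ω)
    exact mul_le_mul h1 (abs_residual_le hf hFb _) (abs_nonneg _) ((abs_nonneg _).trans h1)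
  · rintro ⟨s, t⟩
    rcases (((fun ω : Path 𝒳 => (lambda β γ l ω i, lambda β γ l ω j)) ⁻¹'
      {(s, t)})).eq_empty_or_nonempty with he | ⟨ω₀, hω₀⟩
    · rw [he, setIntegral_empty]
    simp only [mem_preimage, mem_singleton_iff, Prod.mk.injEq] at hω₀
    have hs0 : 0 ≤ s := hω₀.1 ▸ lambda_nonneg β γ l ω₀ i
    have hst : s < t := by
      rw [← hω₀.1, ← hω₀.2]
      exact lambda_strictMono β γ l ω₀ hij
    have ht0 : 0 ≤ t := hs0.trans hst.le
    lift s to ℕ using hs0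
    lift t to ℕ using ht0
    have hE : DecidedAt l t ((fun ω : Path 𝒳 => (lambda β γ l ω i, lambda β γ l ω j)) ⁻¹'
        {((s : ℤ), (t : ℤ))}) := by
      intro ω ω' hω hω' h hm
      simp only [mem_preimage, mem_singleton_iff, Prod.mk.injEq] at hm ⊢
      exact ⟨(hω.lambda_congr hl hω' β γ h (by omega)).trans hm.1,
        (hω.lambda_congr hl hω' β γ h (by omega)).trans hm.2⟩
    set g : (ℕ → 𝒳) → ℝ := fun x => f (x (t - s - 1)) - F (fun r => x (r + (t - s))) with hg
    have hgm : Measurable g :=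
      ((measurable_of_countable f).comp (measurable_pi_apply _)).sub
        (hFm.comp (measurable_pi_iff.2 fun _ => measurable_pi_apply _))
    have hgb : ∀ x, |g x| ≤ M + M := fun x =>
      (abs_sub _ _).trans (add_le_add (hf _) (hFb _))
    have hgr : ∀ ω : Path 𝒳, g (past (shiftBy t ω)) = residual f F (shiftBy s ω) := by
      intro ω
      simp only [hg, residual, past, shiftBy]
      congr 2
      · congr 1
        omega
      · funext r
        congr 1
        omega
    rw [← setIntegral_residual_eq_zero hT hf hF hFm hgm hgb hE]
    refine setIntegral_congr_fun (((measurable_lambda β γ i).prodMk (measurable_lambda β γ j))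
      (measurableSet_singleton _)) fun ω hω => ?_
    simp only [mem_preimage, mem_singleton_iff, Prod.mk.injEq] at hω
    simp only [hgr, hω.1, hω.2]

/-- The average prediction error along the stopping times vanishes. -/
lemma ae_tendsto_average_residual (hT : MeasurePreserving shift μ μ) (hl : BlockLengths l)
    (hf : ∀ x, |f x| ≤ M) (hF : IsPredictor μ f F) (hFm : Measurable F) (hFb : ∀ x, |F x| ≤ M) :
    ∀ᵐ ω ∂μ, Tendsto (fun n : ℕ => (∑ j ∈ Finset.range n,
      residual f F (shiftBy (lambda β γ l ω j) ω)) / n) atTop (𝓝 0) :=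
  tendsto_average_of_orthogonal (fun n => measurable_residual_lambda hFm n)
    (fun _ _ => abs_residual_le hf hFb _)
    fun _ _ hij => integral_residual_mul_residual hT hl hf hF hFm hFb hij

end Residuals

section SegmentFiltration

variable {l : ℕ → ℕ} {β γ : ℝ}

omit [MeasurableSpace 𝒳] in
lemma segObs_eq_iff {n : ℕ} {ω ω' : Path 𝒳} : segObs β γ l n ω = segObs β γ l n ω' ↔
    lambda β γ l ω n = lambda β γ l ω' n ∧ AgreeUpTo (lambda β γ l ω n) ω ω' := by
  simp only [segObs, Prod.mk.injEq]
  refine and_congr_right fun h => ?_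
  rw [← h, funext_iff]
  have h0 := lambda_nonneg β γ l ω n
  refine ⟨fun H i hi hit => ?_, fun H i => H _ (le_max_right _ _) (max_le (by omega) h0)⟩
  have := H (lambda β γ l ω n - i).toNat
  rwa [show max (lambda β γ l ω n - ((lambda β γ l ω n - i).toNat : ℤ)) 0 = i by omega] at this

omit [MeasurableSpace 𝒳] in
lemma countable_range_segObs [Countable 𝒳] (n : ℕ) :
    (range (segObs β γ l n : Path 𝒳 → _)).Countable := by
  refine (countable_iUnion fun t : ℕ => countable_range fun w : Fin (t + 1) → 𝒳 =>
    ((t : ℤ), fun i : ℕ => w ⟨t - i, by omega⟩)).mono ?_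
  rintro _ ⟨ω, rfl⟩
  obtain ⟨t, ht⟩ := Int.eq_ofNat_of_zero_le (lambda_nonneg β γ l ω n)
  refine mem_iUnion.2 ⟨t, initial t ω, ?_⟩
  simp only [segObs, initial, ht, Prod.mk.injEq, true_and]
  funext i
  congr 1
  omega

variable [Countable 𝒳] [MeasurableSingletonClass 𝒳]

/-- The filtration of the events which on recurrent paths are decided by the segment observed
at the time `λ_n`. -/
def segFiltration (hl : BlockLengths l) (β γ : ℝ) :
    Filtration ℕ (inferInstance : MeasurableSpace (Path 𝒳)) where
  seq n :=
    { MeasurableSet' := fun A => MeasurableSet A ∧ ∀ ω ω', IsRecurrent l ω → IsRecurrent l ω' →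
        segObs β γ l n ω = segObs β γ l n ω' → (ω ∈ A ↔ ω' ∈ A)
      measurableSet_empty := ⟨MeasurableSet.empty, fun _ _ _ _ _ => Iff.rfl⟩
      measurableSet_compl := fun _ hA =>
        ⟨hA.1.compl, fun ω ω' hω hω' h => not_congr (hA.2 ω ω' hω hω' h)⟩
      measurableSet_iUnion := fun A hA => ⟨MeasurableSet.iUnion fun i => (hA i).1,
        fun ω ω' hω hω' h => by
          simp only [mem_iUnion]
          exact exists_congr fun i => (hA i).2 ω ω' hω hω' h⟩ }
  mono' := fun i j hij A hA => ⟨hA.1, fun ω ω' hω hω' h => by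
    have hagree := (segObs_eq_iff.1 h).2
    have hle := (lambda_strictMono β γ l ω).monotone hij
    exact hA.2 ω ω' hω hω' (segObs_eq_iff.2
      ⟨(hω.lambda_congr hl hω' β γ hagree hle).symm, hagree.mono hle⟩)⟩
  le' := fun _ _ hA => hA.1

lemma segSigma_le (n : ℕ) :
    segSigma β γ l n ≤ (inferInstance : MeasurableSpace (Path 𝒳)) :=
  (measurable_segObs β γ n).comap_le

lemma segSigma_le_segFiltration (hl : BlockLengths l) (n : ℕ) :
    segSigma β γ l n ≤ segFiltration (𝒳 := 𝒳) hl β γ n := by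
  rintro _ ⟨B, hB, rfl⟩
  exact ⟨measurable_segObs β γ n hB, fun ω ω' _ _ h => by simp only [mem_preimage, h]⟩

lemma measurable_tildePast_iSup (hl : BlockLengths l) :
    Measurable[⨆ n, segFiltration (𝒳 := 𝒳) hl β γ n] (tildePast l) := by
  refine @measurable_pi_lambda _ _ _ (_) _ _ fun i => ?_
  refine @measurable_to_countable' _ _ _ _ (_) _ fun a => ?_
  have h : (fun ω : Path 𝒳 => tildePast l ω i) ⁻¹' {a} =
      ⋃ n : ℕ, {ω | tildePast l ω i = a ∧ zeta l ω (Jfun l i) ≤ n} := by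
    ext ω
    simp only [mem_preimage, mem_singleton_iff, mem_iUnion, mem_ofPred_eq, exists_and_left]
    exact ⟨fun h => ⟨h, _, Int.self_le_toNat _⟩, And.left⟩
  rw [h]
  refine @MeasurableSet.iUnion _ _ (_) _ _ fun n => ?_
  refine le_iSup (fun n => (segFiltration (𝒳 := 𝒳) hl β γ n : MeasurableSpace (Path 𝒳))) n _ ?_
  have key : ∀ ω ω' : Path 𝒳, IsRecurrent l ω → AgreeUpTo (n : ℤ) ω ω' →
      tildePast l ω i = a ∧ zeta l ω (Jfun l i) ≤ n →
      tildePast l ω' i = a ∧ zeta l ω' (Jfun l i) ≤ n := fun ω ω' hω h hn =>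
    ⟨(tildePast_eq_of_agreeUpTo hl hω h hn.2).symm.trans hn.1,
      (zeta_eq_of_agreeUpTo hl hω h hn.2).trans_le hn.2⟩
  refine ⟨?_, fun ω ω' hω hω' h => ?_⟩
  · exact (measurable_pi_iff.1 measurable_tildePast i (measurableSet_singleton a)).inter
      (measurable_zeta (Jfun l i) (measurableSet_Iic (a := (n : ℤ))))
  · have hagree := (segObs_eq_iff.1 h).2.mono (le_lambda β γ l ω n)
    exact ⟨key ω ω' hω hagree, key ω' ω hω' hagree.symm⟩

variable {μ : Measure (Path 𝒳)} [IsProbabilityMeasure μ]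

lemma ae_eq_of_measurableSet_segFiltration (hT : MeasurePreserving shift μ μ) (hl : BlockLengths l)
    {n : ℕ} {A : Set (Path 𝒳)} (hA : MeasurableSet[segFiltration hl β γ n] A) :
    ∃ B, MeasurableSet[segSigma β γ l n] B ∧ A =ᵐ[μ] B := by
  set S := segObs β γ l n '' (A ∩ {ω | IsRecurrent l ω}) with hS
  have hSc : S.Countable := (countable_range_segObs n).mono (image_subset_range _ _)
  refine ⟨segObs β γ l n ⁻¹' S, ⟨S, hSc.measurableSet, rfl⟩, ?_⟩
  filter_upwards [ae_isRecurrent hT l] with ω hω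
  refine propext ⟨fun h => ⟨ω, ⟨h, hω⟩, rfl⟩, ?_⟩
  rintro ⟨ω', ⟨h', hω'⟩, he⟩
  exact (hA.2 ω' ω hω' hω he).1 h'

lemma condExp_segSigma_ae_eq (hT : MeasurePreserving shift μ μ) (hl : BlockLengths l) (n : ℕ)
    {g : Path 𝒳 → ℝ} (hg : Integrable g μ) :
    μ[g|segSigma β γ l n] =ᵐ[μ] μ[g|segFiltration hl β γ n] := by
  refine ae_eq_condExp_of_forall_setIntegral_eq ((segFiltration hl β γ).le n) hg
    (fun _ _ _ => integrable_condExp.integrableOn) (fun A hA _ => ?_)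
    (stronglyMeasurable_condExp.mono (segSigma_le_segFiltration hl n)).aestronglyMeasurable
  obtain ⟨B, hB, hAB⟩ := ae_eq_of_measurableSet_segFiltration hT hl hA
  rw [setIntegral_congr_set hAB, setIntegral_condExp (segSigma_le n) hg hB,
    setIntegral_congr_set hAB]

variable {f : 𝒳 → ℝ} {M : ℝ} {F : (ℕ → 𝒳) → ℝ}

lemma integrable_residual_lambda (hf : ∀ x, |f x| ≤ M) (hFm : Measurable F)
    (hFb : ∀ x, |F x| ≤ M) (n : ℕ) :
    Integrable (fun ω : Path 𝒳 => residual f F (shiftBy (lambda β γ l ω n) ω)) μ :=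
  Integrable.of_bound (measurable_residual_lambda hFm n).aestronglyMeasurable (2 * M)
    (Eventually.of_forall fun _ => abs_residual_le hf hFb _)

lemma condExp_residual_lambda (hT : MeasurePreserving shift μ μ) (hl : BlockLengths l)
    (hf : ∀ x, |f x| ≤ M) (hF : IsPredictor μ f F) (hFm : Measurable F) (hFb : ∀ x, |F x| ≤ M)
    (n : ℕ) :
    μ[fun ω => residual f F (shiftBy (lambda β γ l ω n) ω)|segFiltration hl β γ n] =ᵐ[μ] 0 := by
  have hi : Integrable (fun ω => residual f F (shiftBy (lambda β γ l ω n) ω)) μ :=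
    integrable_residual_lambda hf hFm hFb n
  refine (ae_eq_condExp_of_forall_setIntegral_eq ((segFiltration hl β γ).le n) hi
    (fun _ _ _ => (integrable_zero _ _ _).integrableOn) (fun A hA _ => ?_)
    aestronglyMeasurable_zero).symm
  have hlam := measurable_lambda (𝒳 := 𝒳) (l := l) β γ n
  simp only [Pi.zero_apply, integral_zero]
  refine (integral_eq_zero_of_fibers hlam hi.integrableOn fun t => ?_).symm
  have ht := hlam (measurableSet_singleton t)
  rw [Measure.restrict_restrict ht]
  rcases lt_or_ge t 0 with h | h
  · have he : (fun ω : Path 𝒳 => lambda β γ l ω n) ⁻¹' {t} ∩ A = ∅ :=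
      eq_empty_of_forall_notMem fun ω hω => by
        have h1 : lambda β γ l ω n = t := hω.1
        have := lambda_nonneg β γ l ω n
        omega
    rw [he, setIntegral_empty]
  lift t to ℕ using h
  have hE : DecidedAt l t ((fun ω : Path 𝒳 => lambda β γ l ω n) ⁻¹' {(t : ℤ)} ∩ A) := by
    rintro ω ω' hω hω' h ⟨h1 : lambda β γ l ω n = t, h2⟩
    have h3 := hω.lambda_congr hl hω' β γ h h1.le
    exact ⟨h3.trans h1, (hA.2 ω ω' hω hω' (segObs_eq_iff.2 ⟨h3.symm, h.mono h1.le⟩)).1 h2⟩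
  rw [← setIntegral_residual_eq_zero hT hf hF hFm (measurable_const (a := (1 : ℝ)))
    (fun _ => abs_one.le) hE]
  refine setIntegral_congr_fun (ht.inter hA.1) fun ω hω => ?_
  have h1 : lambda β γ l ω n = t := hω.1
  simp only [h1, one_mul]

lemma ae_tendsto_condExp_segSigma (hT : MeasurePreserving shift μ μ) (hl : BlockLengths l)
    (hf : ∀ x, |f x| ≤ M) (hF : IsPredictor μ f F) (hFm : Measurable F) (hFb : ∀ x, |F x| ≤ M)
    (hlim : ∀ᵐ ω ∂μ, Tendsto (fun n => F (past (shiftBy (lambda β γ l ω n) ω))) atTop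
      (𝓝 (F (tildePast l ω)))) :
    ∀ᵐ ω ∂μ, Tendsto (fun n => (μ[fun ω' => f (ω' (lambda β γ l ω' n + 1))|segSigma β γ l n]) ω)
      atTop (𝓝 (F (tildePast l ω))) := by
  have hYm : ∀ n, Measurable fun ω : Path 𝒳 => F (past (shiftBy (lambda β γ l ω n) ω)) := fun n =>
    hFm.comp (measurable_past.comp (measurable_shiftBy_comp (measurable_lambda β γ n)))
  have hYi : ∀ n, Integrable (fun ω : Path 𝒳 => F (past (shiftBy (lambda β γ l ω n) ω))) μ :=
    fun n => Integrable.of_bound (hYm n).aestronglyMeasurable M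
      (Eventually.of_forall fun _ => hFb _)
  have hri : ∀ n, Integrable (fun ω => residual f F (shiftBy (lambda β γ l ω n) ω)) μ :=
    integrable_residual_lambda hf hFm hFb
  have hdec : ∀ n, (fun ω : Path 𝒳 => f (ω (lambda β γ l ω n + 1))) =
      (fun ω => residual f F (shiftBy (lambda β γ l ω n) ω)) +
        fun ω => F (past (shiftBy (lambda β γ l ω n) ω)) := fun n => by
    funext ω
    simp [residual, shiftBy, add_comm]
  have heq : ∀ n, μ[fun ω' => f (ω' (lambda β γ l ω' n + 1))|segSigma β γ l n] =ᵐ[μ]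
      μ[fun ω => F (past (shiftBy (lambda β γ l ω n) ω))|segFiltration hl β γ n] := fun n => by
    have h1 := condExp_segSigma_ae_eq (β := β) (γ := γ) hT hl n ((hri n).add (hYi n))
    have h2 := condExp_add (hri n) (hYi n) (segFiltration hl β γ n)
    rw [hdec]
    filter_upwards [h1, h2, condExp_residual_lambda hT hl hf hF hFm hFb n] with ω e1 e2 e3
    rw [e1, e2, Pi.add_apply, e3, Pi.zero_apply, zero_add]
  have hhunt := tendsto_condExp_of_tendsto_of_bounded (segFiltration hl β γ) hYm
    (fun _ _ => hFb _) (hFm.comp measurable_tildePast) (fun _ => hFb _)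
    (hFm.comp (measurable_tildePast_iSup hl)).aestronglyMeasurable hlim
  filter_upwards [ae_all_iff.2 heq, hhunt] with ω h1 h2
  exact h2.congr fun n => (h1 n).symm

end SegmentFiltration

/-- Theorem, first part. For a stationary ergodic process with
almost surely continuous conditional expectation `F`, almost surely
`f_n → F(X̃⁰_{-∞})` and `|f_n - E(f(X_{λ_n+1}) | X_0^{λ_n})| → 0`. -/
theorem statement0
    {𝒳 : Type*} [Countable 𝒳] [MeasurableSpace 𝒳] [MeasurableSingletonClass 𝒳]
    (μ : Measure (Path 𝒳)) [IsProbabilityMeasure μ]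
    (hErg : Ergodic (shift : Path 𝒳 → Path 𝒳) μ)
    (l : ℕ → ℕ) (hl1 : l 1 = 1) (hlmono : Monotone l)
    (hlle : ∀ k, 1 ≤ k → l k ≤ k) (hltop : Tendsto l atTop atTop)
    (β γ : ℝ) (hγ0 : 0 < γ) (hγ1 : γ < 1) (hβ0 : 0 < β) (hβγ : 2 * β + γ < 1)
    (f : 𝒳 → ℝ) (hf : ∃ M, ∀ x, |f x| ≤ M)
    (F : (ℕ → 𝒳) → ℝ) (hF : IsPredictor μ f F)
    (hFcont : ASContinuousCondExp μ F) :
    ∀ᵐ ω ∂μ,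
      Tendsto (fun n => fEst β γ l f ω n) atTop (nhds (F (tildePast l ω))) ∧
      Tendsto (fun n =>
          |fEst β γ l f ω n -
            (μ[fun ω' => f (ω' (lambda β γ l ω' n + 1))|segSigma β γ l n]) ω|)
        atTop (nhds 0) := by
  have hl : BlockLengths l := ⟨hlmono, hlle, hltop⟩
  have hT := hErg.toMeasurePreserving
  obtain ⟨M, hM⟩ := hf
  obtain ⟨F', hFm, hFb, hF', hFF⟩ := hF.exists_bounded hM
  obtain ⟨G, hG0, hG⟩ := hFcont.exists_regularOn hT hM hFm hF' hFF
  have htilde : ∀ᵐ ω ∂μ, tildePast l ω ∈ G := by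
    refine ae_of_ae_map (p := (· ∈ G)) measurable_tildePast.aemeasurable ?_
    rw [map_tildePast hT hl]
    exact map_eq_zero_of_preimage_eq_zero measurable_past hG0
  have hshift : ∀ᵐ ω ∂μ, ∀ t : ℤ, past (shiftBy t ω) ∈ G :=
    ae_all_iff.2 fun t => (measurePreserving_shiftBy hT t).quasiMeasurePreserving.ae hG0
  have hlim : ∀ᵐ ω ∂μ, Tendsto (fun n => F' (past (shiftBy (lambda β γ l ω n) ω))) atTop
      (𝓝 (F' (tildePast l ω))) := by
    filter_upwards [ae_isRecurrent hT l, htilde, hshift, ae_eventually_le_chi hErg l hβ0 hγ0]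
      with ω hω h0 h1 hchi
    exact hG.tendsto_lambda hl hω h0 h1 hchi
  filter_upwards [htilde, hlim, ae_tendsto_average_residual (β := β) (γ := γ) hT hl hM hF' hFm hFb,
    ae_tendsto_condExp_segSigma hT hl hM hF' hFm hFb hlim] with ω h0 h1 h2 h3
  have h4 : Tendsto (fun n => fEst β γ l f ω n) atTop (𝓝 (F' (tildePast l ω))) := by
    rw [← zero_add (F' (tildePast l ω))]
    refine (h2.add h1.cesaro).congr fun n => ?_
    rw [fEst, div_eq_inv_mul, ← mul_add, ← Finset.sum_add_distrib, one_div]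
    simp [residual, shiftBy, add_comm]
  refine ⟨by rwa [hG.eq _ h0], ?_⟩
  simpa using (h4.sub h3).abs

end MWPrediction
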